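/- Under Condition (B) (Q₂(n) = o(nQ₁(n))), for any s₁, s₂ ∈ (0,1) and any a ∈ (0,1), one has lim_{n→∞} E[s₁^{Z₁(⌊an⌋,n)} s₂^{Z₂(⌊an⌋,n)} | Z(n) ≠ 0, Z(0)=e₂] = 1 - (a + (1-a)(1-s₁)^{-α₁})^{-1/(α₁(1+α₂))}. -/

import Mathlib

open MeasureTheory Filter Topology

/-- `a(n) ~ b(n)` : the ratio tends to `1` as `n → ∞`. -/
def Asymp (f g : ℕ → ℝ) : Prop :=
  Filter.Tendsto (fun n => f n / g n) Filter.atTop (nhds 1)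

/-- A critical decomposable two-type Galton–Watson process together with its
reduced process.  `P1` is the law of the process started from one particle of
type 1 (`Z(0) = e₁`), `P2` the law started from one particle of type 2
(`Z(0) = e₂`).  `Z1 n`/`Z2 n` are the numbers of particles of types 1 and 2 at
time `n`; `R1 m n`/`R2 m n` are the numbers of particles of types 1 and 2 alive
at time `m` having descendants at time `n` (the reduced process). -/
structure GWSetup where
  (Ω : Type)
  [mΩ : MeasurableSpace Ω]
  (P1 : Measure Ω)
  (P2 : Measure Ω)
  (hprob1 : IsProbabilityMeasure P1)
  (hprob2 : IsProbabilityMeasure P2)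
  (Z1 : ℕ → Ω → ℕ)
  (Z2 : ℕ → Ω → ℕ)
  (R1 : ℕ → ℕ → Ω → ℕ)
  (R2 : ℕ → ℕ → Ω → ℕ)
  (mZ1 : ∀ n, Measurable (Z1 n))
  (mZ2 : ∀ n, Measurable (Z2 n))
  (mR1 : ∀ m n, Measurable (R1 m n))
  (mR2 : ∀ m n, Measurable (R2 m n))
  (α1 : ℝ)
  (α2 : ℝ)
  (A21 : ℝ)
  (L1 : ℝ → ℝ)
  (L2 : ℝ → ℝ)
  (ρ : ℝ → ℝ → ℝ)
  (hα1 : 0 < α1 ∧ α1 ≤ 1)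
  (hα2 : 0 < α2 ∧ α2 ≤ 1)
  (hA21 : 0 < A21)
  -- initial states
  (hinit1 : ∀ᵐ ω ∂P1, Z1 0 ω = 1 ∧ Z2 0 ω = 0)
  (hinit2 : ∀ᵐ ω ∂P2, Z1 0 ω = 0 ∧ Z2 0 ω = 1)
  -- type-1 particles produce only type-1 particles
  (hdecomp : ∀ n, ∀ᵐ ω ∂P1, Z2 n ω = 0)
  -- criticality
  (hcrit1 : (∫ ω, (Z1 1 ω : ℝ) ∂P1) = 1)
  (hcrit2 : (∫ ω, (Z2 1 ω : ℝ) ∂P2) = 1)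
  -- mean number of type-1 children of a type-2 particle
  (hmean21 : (∫ ω, (Z1 1 ω : ℝ) ∂P2) = A21)
  -- assumption (F1)
  (hF1 : ∀ s : ℝ, 0 ≤ s → s < 1 →
    (∫ ω, s ^ Z1 1 ω ∂P1) = s + (1 - s) ^ (1 + α1) * L1 (1 - s))
  -- assumption (F2)
  (hF2 : ∀ s1 s2 : ℝ, 0 ≤ s1 → s1 ≤ 1 → 0 ≤ s2 → s2 < 1 →
    (∫ ω, s1 ^ Z1 1 ω * s2 ^ Z2 1 ω ∂P2) =
      s2 + (1 - s2) ^ (1 + α2) * L2 (1 - s2) - (A21 - ρ s1 s2) * (1 - s1))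
  -- `L1`, `L2` are slowly varying at `0`
  (hL1 : ∀ c : ℝ, 0 < c →
    Filter.Tendsto (fun x => L1 (c * x) / L1 x) (nhdsWithin 0 (Set.Ioi 0)) (nhds 1))
  (hL2 : ∀ c : ℝ, 0 < c →
    Filter.Tendsto (fun x => L2 (c * x) / L2 x) (nhdsWithin 0 (Set.Ioi 0)) (nhds 1))
  -- `ρ(s₁,s₂) → 0` as `s₁ s₂ ↑ 1`
  (hρ : ∀ ε : ℝ, 0 < ε → ∃ δ : ℝ, 0 < δ ∧ ∀ s1 s2 : ℝ,
    0 ≤ s1 → s1 ≤ 1 → 0 ≤ s2 → s2 ≤ 1 → 1 - δ < s1 * s2 → |ρ s1 s2| < ε)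
  -- branching (semigroup) property at the level of generating functions
  (hbranch1 : ∀ m n : ℕ, ∀ s : ℝ, 0 ≤ s → s ≤ 1 →
    (∫ ω, s ^ Z1 (m + n) ω ∂P1) = ∫ ω, (∫ ω', s ^ Z1 n ω' ∂P1) ^ Z1 m ω ∂P1)
  (hbranch2 : ∀ m n : ℕ, ∀ s1 s2 : ℝ, 0 ≤ s1 → s1 ≤ 1 → 0 ≤ s2 → s2 ≤ 1 →
    (∫ ω, s1 ^ Z1 (m + n) ω * s2 ^ Z2 (m + n) ω ∂P2) =
      ∫ ω, (∫ ω', s1 ^ Z1 n ω' ∂P1) ^ Z1 m ω *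
        (∫ ω', s1 ^ Z1 n ω' * s2 ^ Z2 n ω' ∂P2) ^ Z2 m ω ∂P2)
  -- the reduced process vanishes on the extinction event
  (hext : ∀ m n : ℕ, ∀ᵐ ω ∂P2,
    (Z1 n ω = 0 ∧ Z2 n ω = 0) → (R1 m n ω = 0 ∧ R2 m n ω = 0))
  -- the generating function of the reduced process (conditioning on `Z(m)`)
  (hreduced : ∀ m n : ℕ, m ≤ n → ∀ s1 s2 : ℝ, 0 ≤ s1 → s1 ≤ 1 → 0 ≤ s2 → s2 ≤ 1 →
    (∫ ω, s1 ^ R1 m n ω * s2 ^ R2 m n ω ∂P2) =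
      ∫ ω, (1 - (1 - s1) * (P1 {ω' | Z1 (n - m) ω' ≠ 0}).toReal) ^ Z1 m ω *
        (1 - (1 - s2) *
          (P2 {ω' | Z1 (n - m) ω' ≠ 0 ∨ Z2 (n - m) ω' ≠ 0}).toReal) ^ Z2 m ω ∂P2)

namespace GWSetup

variable (S : GWSetup)

/-- The survival event `{Z(n) ≠ 0}` (under the law `P2`). -/
def surv (n : ℕ) : Set S.Ω := {ω | S.Z1 n ω ≠ 0 ∨ S.Z2 n ω ≠ 0}

/-- `Q₁(n) = P(Z₁(n) > 0 | Z(0) = e₁)`. -/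
noncomputable def Q1 (n : ℕ) : ℝ := (S.P1 {ω | S.Z1 n ω ≠ 0}).toReal

/-- `Q₂(n) = P(Z₂(n) > 0 | Z(0) = e₂)`. -/
noncomputable def Q2 (n : ℕ) : ℝ := (S.P2 {ω | S.Z2 n ω ≠ 0}).toReal

/-- `Q₂₁(n) = P(Z(n) ≠ 0 | Z(0) = e₂)`. -/
noncomputable def Q21 (n : ℕ) : ℝ := (S.P2 (S.surv n)).toReal

/-- `F₁(n; s) = E[s^{Z₁(n)} | Z(0) = e₁]`. -/
noncomputable def F1 (n : ℕ) (s : ℝ) : ℝ := ∫ ω, s ^ S.Z1 n ω ∂S.P1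

/-- `F₂₁(n; s₁, s₂) = E[s₁^{Z₁(n)} s₂^{Z₂(n)} | Z(0) = e₂]`. -/
noncomputable def F21 (n : ℕ) (s1 s2 : ℝ) : ℝ :=
  ∫ ω, s1 ^ S.Z1 n ω * s2 ^ S.Z2 n ω ∂S.P2

/-- `Q₁(n; s) = 1 - F₁(n; s)`. -/
noncomputable def Q1s (n : ℕ) (s : ℝ) : ℝ := 1 - S.F1 n s

/-- `Q₂(n; s) = 1 - E[s^{Z₂(n)} | Z(0) = e₂]`. -/
noncomputable def Q2s (n : ℕ) (s : ℝ) : ℝ := 1 - S.F21 n 1 s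

/-- `Q₂₁(n; s₁, s₂) = 1 - F₂₁(n; s₁, s₂)`. -/
noncomputable def Q21s (n : ℕ) (s1 s2 : ℝ) : ℝ := 1 - S.F21 n s1 s2

/-- The conditional expectation
`E[f(Z₁(m,n), Z₂(m,n)) | Z(n) ≠ 0, Z(0) = e₂]` for the reduced process. -/
noncomputable def Ered (m n : ℕ) (f : ℕ → ℕ → ℝ) : ℝ :=
  (∫ ω in S.surv n, f (S.R1 m n ω) (S.R2 m n ω) ∂S.P2) / S.Q21 n

/-- The conditional probability `P(E | Z(n) ≠ 0, Z(0) = e₂)`. -/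
noncomputable def Pred (n : ℕ) (E : Set S.Ω) : ℝ :=
  (S.P2 (E ∩ S.surv n)).toReal / S.Q21 n

/-- The birth time `β_n` of the most recent common ancestor of the population
alive at time `n`:  `β_n = max {m < n : Z₁(m,n) + Z₂(m,n) = 1}`. -/
noncomputable def beta (n : ℕ) (ω : S.Ω) : ℕ :=
  sSup {m | m < n ∧ S.R1 m n ω + S.R2 m n ω = 1}

/-- The type `T_n` of the most recent common ancestor: the `i ∈ {1,2}` with
`Z_i(β_n, n) = 1`. -/
noncomputable def mrcaType (n : ℕ) (ω : S.Ω) : ℕ :=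
  if S.R2 (S.beta n ω) n ω = 1 then 2 else 1

/-- Condition (A): `n Q₁(n) = o(Q₂(n))`. -/
def CondA : Prop :=
  Filter.Tendsto (fun n : ℕ => (n : ℝ) * S.Q1 n / S.Q2 n) Filter.atTop (nhds 0)

/-- Condition (B): `Q₂(n) = o(n Q₁(n))`. -/
def CondB : Prop :=
  Filter.Tendsto (fun n : ℕ => S.Q2 n / ((n : ℝ) * S.Q1 n)) Filter.atTop (nhds 0)

/-- Condition (C): `n Q₁(n) ~ σ Q₂(n)`. -/
def CondC (σ : ℝ) : Prop := Asymp (fun n : ℕ => (n : ℝ) * S.Q1 n) (fun n => σ * S.Q2 n)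

/-- `h*` is an integer-valued function with
`(α₁ A₂₁ / (1 - α₁)) h*(n) Q₁(h*(n)) ~ Q₂(n)`. -/
def IsHStar (h : ℕ → ℕ) : Prop :=
  Asymp (fun n : ℕ => S.α1 * S.A21 / (1 - S.α1) * (h n : ℝ) * S.Q1 (h n)) S.Q2

/-- `g*` is an integer-valued function with `Q₂(g*(n)) ~ Q₂₁(n)`. -/
def IsGStar (g : ℕ → ℕ) : Prop := Asymp (fun n => S.Q2 (g n)) S.Q21

end GWSetup

/-- If `H` is positive and monotone on `(0, 1]` and regularly varying at `0` with index `β > 0`, then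
convergence of `H u / H v` forces convergence of `u / v`. -/
theorem tendsto_div_of_regularlyVarying {H : ℝ → ℝ} {β : ℝ} (hβ : 0 < β)
    (hmono : MonotoneOn H (Set.Ioc 0 1)) (hpos : ∀ x ∈ Set.Ioc (0 : ℝ) 1, 0 < H x)
    (hrv : ∀ c : ℝ, 0 < c → Tendsto (fun x => H (c * x) / H x) (𝓝[>] 0) (𝓝 (c ^ β)))
    {u v : ℕ → ℝ} (hu : ∀ᶠ n in atTop, u n ∈ Set.Ioc (0 : ℝ) 1)
    (hv : Tendsto v atTop (𝓝[>] 0)) {r : ℝ} (hr : 0 < r)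
    (h : Tendsto (fun n => H (u n) / H (v n)) atTop (𝓝 r)) :
    Tendsto (fun n => u n / v n) atTop (𝓝 (r ^ (1 / β))) := by
  have hv0 : Tendsto v atTop (𝓝 0) := hv.mono_right nhdsWithin_le_nhds
  have hvpos : ∀ᶠ n in atTop, 0 < v n := hv.eventually self_mem_nhdsWithin
  have hsmall : ∀ c : ℝ, 0 < c → ∀ᶠ n in atTop, c * v n < 1 := fun c _ => by
    have : Tendsto (fun n => c * v n) atTop (𝓝 0) := by simpa using hv0.const_mul c
    exact this.eventually (gt_mem_nhds one_pos)
  have hrr : (r ^ (1 / β)) ^ β = r := by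
    rw [← Real.rpow_mul hr.le, one_div_mul_cancel hβ.ne', Real.rpow_one]
  have hrp : 0 < r ^ (1 / β) := Real.rpow_pos_of_pos hr _
  rw [tendsto_order]
  constructor
  · intro c hc
    rcases le_or_gt c 0 with hc0 | hc0
    · filter_upwards [hu, hvpos] with n h1 h2
      exact lt_of_le_of_lt hc0 (div_pos h1.1 h2)
    · have hlt : c ^ β < r := by
        rw [← hrr]; exact Real.rpow_lt_rpow hc0.le hc hβ
      obtain ⟨q, hq1, hq2⟩ := exists_between hlt
      filter_upwards [hu, hvpos, hsmall c hc0, hsmall 1 one_pos,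
        h.eventually (lt_mem_nhds hq2), ((hrv c hc0).comp hv).eventually (gt_mem_nhds hq1)]
        with n h1 h2 h3 h4 h5 h6
      have hHv : 0 < H (v n) := hpos _ ⟨h2, by linarith⟩
      rw [lt_div_iff₀ h2]
      by_contra hcon
      have := hmono h1 ⟨mul_pos hc0 h2, h3.le⟩ (not_lt.mp hcon)
      have h7 := div_le_div_of_nonneg_right this hHv.le
      simp only [Function.comp] at h6
      linarith
  · intro c hc
    have hc0 : 0 < c := hrp.trans hc
    have hlt : r < c ^ β := by
      rw [← hrr]; exact Real.rpow_lt_rpow hrp.le hc hβ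
    obtain ⟨q, hq1, hq2⟩ := exists_between hlt
    filter_upwards [hu, hvpos, hsmall c hc0, hsmall 1 one_pos,
      h.eventually (gt_mem_nhds hq1), ((hrv c hc0).comp hv).eventually (lt_mem_nhds hq2)]
      with n h1 h2 h3 h4 h5 h6
    have hHv : 0 < H (v n) := hpos _ ⟨h2, by linarith⟩
    rw [div_lt_iff₀ h2]
    by_contra hcon
    have := hmono ⟨mul_pos hc0 h2, h3.le⟩ h1 (not_lt.mp hcon)
    have h7 := div_le_div_of_nonneg_right this hHv.le
    simp only [Function.comp] at h6
    linarith

/-- `D x = F (1 - x) - (1 - x)` for a critical offspring generating function `F` such that `D` is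
regularly varying at `0` with index `1 + α`. -/
structure CriticalRV (D : ℝ → ℝ) (α : ℝ) : Prop where
  conv : ConvexOn ℝ (Set.Icc 0 1) D
  zero : D 0 = 0
  nonneg : ∀ x ∈ Set.Icc (0 : ℝ) 1, 0 ≤ D x
  one_lt : D 1 < 1
  mono_sub : MonotoneOn (fun x => x - D x) (Set.Icc 0 1)
  index_pos : 0 < α
  rv : ∀ c : ℝ, 0 < c → Tendsto (fun x => D (c * x) / D x) (𝓝[>] 0) (𝓝 (c ^ (1 + α)))

namespace CriticalRV

variable {D : ℝ → ℝ} {α : ℝ}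

theorem quot_mono (h : CriticalRV D α) : MonotoneOn (fun x => D x / x) (Set.Ioc 0 1) := by
  intro x hx y hy hxy
  have hconv := h.conv.2
  have := hconv (Set.left_mem_Icc.2 zero_le_one) ⟨hy.1.le, hy.2⟩
    (show 0 ≤ 1 - x / y by rw [sub_nonneg, div_le_one hy.1]; exact hxy)
    (div_nonneg hx.1.le hy.1.le) (by ring)
  simp only [smul_eq_mul, mul_zero, zero_add, h.zero] at this
  rw [div_mul_cancel₀ _ hy.1.ne'] at this
  show D x / x ≤ D y / y
  rw [div_le_iff₀ hx.1]
  calc D x ≤ x / y * D y := this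
    _ = _ := by ring

theorem pos (h : CriticalRV D α) {x : ℝ} (hx : x ∈ Set.Ioc (0 : ℝ) 1) : 0 < D x := by
  have h1 := h.rv 1 one_pos
  have h2 : ∀ᶠ y in 𝓝[>] (0 : ℝ), 0 < D (1 * y) / D y :=
    h1.eventually (lt_mem_nhds (Real.rpow_pos_of_pos one_pos _))
  have h3 : ∀ᶠ y in 𝓝[>] (0 : ℝ), y ∈ Set.Ioc 0 x := Ioc_mem_nhdsGT hx.1
  obtain ⟨y, hy, hyx⟩ := (h2.and h3).exists
  have hne : D y ≠ 0 := by rintro h0; simp [h0] at hy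
  have hy1 : y ∈ Set.Ioc (0 : ℝ) 1 := ⟨hyx.1, hyx.2.trans hx.2⟩
  have hpos : 0 < D y := lt_of_le_of_ne (h.nonneg y ⟨hy1.1.le, hy1.2⟩) hne.symm
  have := h.quot_mono hy1 hx hyx.2
  have h4 : 0 < D x / x := lt_of_lt_of_le (div_pos hpos hy1.1) this
  exact (div_pos_iff_of_pos_right hx.1).1 h4

theorem quot_pos (h : CriticalRV D α) {x : ℝ} (hx : x ∈ Set.Ioc (0 : ℝ) 1) : 0 < D x / x :=
  div_pos (h.pos hx) hx.1

theorem mono (h : CriticalRV D α) : MonotoneOn D (Set.Ioc 0 1) := by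
  intro x hx y hy hxy
  have h1 := h.quot_mono hx hy hxy
  have h2 := mul_le_mul h1 hxy hx.1.le (h.quot_pos hy).le
  simpa [div_mul_cancel₀ _ hx.1.ne', div_mul_cancel₀ _ hy.1.ne'] using h2

theorem lt_self (h : CriticalRV D α) {x : ℝ} (hx : x ∈ Set.Ioc (0 : ℝ) 1) : D x < x := by
  have h1 := h.quot_mono hx (Set.right_mem_Ioc.2 one_pos) hx.2
  simp only [div_one] at h1
  have := h1.trans_lt h.one_lt
  rwa [div_lt_one hx.1] at this

theorem quot_rv (h : CriticalRV D α) (c : ℝ) (hc : 0 < c) :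
    Tendsto (fun x => (D (c * x) / (c * x)) / (D x / x)) (𝓝[>] 0) (𝓝 (c ^ α)) := by
  have h1 := (h.rv c hc).div_const c
  have h2 : c ^ (1 + α) / c = c ^ α := by
    rw [Real.rpow_add hc, Real.rpow_one]; field_simp
  rw [h2] at h1
  refine h1.congr' ?_
  filter_upwards [Ioc_mem_nhdsGT one_pos] with x hx
  have := hx.1.ne'
  have := (h.pos hx).ne'
  field_simp

theorem quot_tendsto_zero (h : CriticalRV D α) :
    Tendsto (fun x => D x / x) (𝓝[>] 0) (𝓝 0) := by
  obtain ⟨l, hl⟩ : ∃ l, Tendsto (fun x => D x / x) (𝓝[>] 0) (𝓝 l) := by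
    refine ⟨_, MonotoneOn.tendsto_nhdsWithin_Ioo_right (x := 0) (y := 1) (by simp)
      (h.quot_mono.mono Set.Ioo_subset_Ioc_self) ?_⟩
    refine ⟨0, ?_⟩
    rintro _ ⟨x, hx, rfl⟩
    exact (h.quot_pos ⟨hx.1, hx.2.le⟩).le
  have hmul : Tendsto (fun x : ℝ => 1 / 2 * x) (𝓝[>] 0) (𝓝[>] 0) := by
    refine tendsto_nhdsWithin_iff.2 ⟨?_, ?_⟩
    · have : Tendsto (fun x : ℝ => 1 / 2 * x) (𝓝 0) (𝓝 (1 / 2 * 0)) :=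
        (continuous_const.mul continuous_id).tendsto 0
      rw [mul_zero] at this
      exact this.mono_left nhdsWithin_le_nhds
    · filter_upwards [self_mem_nhdsWithin] with x hx
      have : (0 : ℝ) < x := hx
      show 0 < 1 / 2 * x
      linarith
  by_cases hl0 : l = 0
  · rwa [hl0] at hl
  · exfalso
    have h1 := (hl.comp hmul).div hl hl0
    rw [div_self hl0] at h1
    have h2 := tendsto_nhds_unique h1 (h.quot_rv (1 / 2) (by norm_num))
    have h3 : (1 / 2 : ℝ) ^ α < 1 :=
      Real.rpow_lt_one (by norm_num) (by norm_num) h.index_pos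
    linarith

/-- The slope of `u ↦ D (u x) / D x` at `1` tends to `1 + α`. -/
theorem slope_tendsto (h : CriticalRV D α) {ε : ℝ → ℝ} (hε : Tendsto ε (𝓝[>] 0) (𝓝[>] 0)) :
    Tendsto (fun x => (1 - D ((1 - ε x) * x) / D x) / ε x) (𝓝[>] 0) (𝓝 (1 + α)) := by
  have hder : HasDerivAt (fun u : ℝ => u ^ (1 + α)) (1 + α) 1 := by
    simpa using Real.hasDerivAt_rpow_const (x := 1) (p := 1 + α) (Or.inl one_ne_zero)
  have hslope := hasDerivAt_iff_tendsto_slope.1 hder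
  have hε0 : ∀ᶠ x in 𝓝[>] (0 : ℝ), 0 < ε x := hε.eventually self_mem_nhdsWithin
  have hεlt : ∀ d : ℝ, 0 < d → ∀ᶠ x in 𝓝[>] (0 : ℝ), ε x < d := fun d hd =>
    (hε.mono_right nhdsWithin_le_nhds).eventually (gt_mem_nhds hd)
  have hsl : ∀ x y z : ℝ, x ∈ Set.Icc (0 : ℝ) 1 → z ∈ Set.Icc (0 : ℝ) 1 → x < y → y < z →
      (D y - D x) / (y - x) ≤ (D z - D y) / (z - y) := fun x y z hx hz hxy hyz =>
    h.conv.slope_mono_adjacent hx hz hxy hyz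
  rw [tendsto_order]
  constructor
  · intro b hb
    have h1 : ∀ᶠ u in 𝓝[<] (1 : ℝ), b < slope (fun u : ℝ => u ^ (1 + α)) 1 u :=
      (hslope.mono_left (nhdsWithin_mono _ (fun u hu => ne_of_lt hu))).eventually (lt_mem_nhds hb)
    have h2 : ∀ᶠ u in 𝓝[<] (1 : ℝ), u ∈ Set.Ioo (0 : ℝ) 1 := Ioo_mem_nhdsLT one_pos
    obtain ⟨u, hu, hu0, hu1⟩ := (h1.and h2).exists
    rw [slope_def_field, Real.one_rpow] at hu
    have h3 : Tendsto (fun x => (D (u * x) / D x - 1) / (u - 1)) (𝓝[>] 0)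
        (𝓝 ((u ^ (1 + α) - 1) / (u - 1))) := ((h.rv u hu0).sub_const 1).div_const _
    filter_upwards [h3.eventually (lt_mem_nhds hu), hε0, hεlt (1 - u) (by linarith),
      Ioc_mem_nhdsGT one_pos] with x h4 h5 h6 hx
    refine h4.trans_le ?_
    have hD := h.pos hx
    have hx0 := hx.1
    have e1 : u * x < (1 - ε x) * x := mul_lt_mul_of_pos_right (by linarith) hx0
    have e2 : (1 - ε x) * x < x := by nlinarith
    have e3 := h.conv.secant_mono (a := x) (x := u * x) (y := (1 - ε x) * x)
      ⟨hx0.le, hx.2⟩ ⟨by positivity, by nlinarith [hx.2]⟩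
      ⟨by nlinarith [mul_pos hu0 hx0], by linarith [hx.2]⟩ (by nlinarith) e2.ne e1.le
    have e4 : (D (u * x) / D x - 1) / (u - 1) = (D (u * x) - D x) / (u * x - x) * (x / D x) := by
      have : u - 1 ≠ 0 := by linarith
      have : u * x - x ≠ 0 := by nlinarith
      field_simp
    have e5 : (1 - D ((1 - ε x) * x) / D x) / ε x
        = (D ((1 - ε x) * x) - D x) / ((1 - ε x) * x - x) * (x / D x) := by
      have : (1 - ε x) * x - x = - (ε x * x) := by ring
      rw [this]
      field_simp
      ring
    rw [e4, e5]
    exact mul_le_mul_of_nonneg_right e3 (by positivity)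
  · intro b hb
    have h1 : ∀ᶠ u in 𝓝[>] (1 : ℝ), slope (fun u : ℝ => u ^ (1 + α)) 1 u < b :=
      (hslope.mono_left (nhdsWithin_mono _ (fun u hu => ne_of_gt hu))).eventually (gt_mem_nhds hb)
    obtain ⟨u, hu, hu1⟩ := (h1.and self_mem_nhdsWithin).exists
    have hu1 : 1 < u := hu1
    have hu0 : 0 < u := by linarith
    rw [slope_def_field, Real.one_rpow] at hu
    have h3 : Tendsto (fun x => (D (u * x) / D x - 1) / (u - 1)) (𝓝[>] 0)
        (𝓝 ((u ^ (1 + α) - 1) / (u - 1))) := ((h.rv u hu0).sub_const 1).div_const _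
    filter_upwards [h3.eventually (gt_mem_nhds hu), hε0, hεlt 1 one_pos,
      Ioc_mem_nhdsGT one_pos, Ioc_mem_nhdsGT (inv_pos.2 hu0)] with x h4 h5 h6 hx hxu
    refine lt_of_le_of_lt ?_ h4
    have hD := h.pos hx
    have hx0 := hx.1
    have hux : u * x ≤ 1 := by
      calc u * x ≤ u * u⁻¹ := mul_le_mul_of_nonneg_left hxu.2 hu0.le
        _ = 1 := mul_inv_cancel₀ hu0.ne'
    have e2 : (1 - ε x) * x < x := by nlinarith
    have e3 := hsl ((1 - ε x) * x) x (u * x)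
      ⟨mul_nonneg (by linarith) hx0.le, by linarith [hx.2]⟩ ⟨by positivity, hux⟩ e2 (by nlinarith)
    have e4 : (D (u * x) / D x - 1) / (u - 1) = (D (u * x) - D x) / (u * x - x) * (x / D x) := by
      have : u - 1 ≠ 0 := by linarith
      have : u * x - x ≠ 0 := by nlinarith
      field_simp
    have e5 : (1 - D ((1 - ε x) * x) / D x) / ε x
        = (D x - D ((1 - ε x) * x)) / (x - (1 - ε x) * x) * (x / D x) := by
      have : x - (1 - ε x) * x = ε x * x := by ring
      rw [this]
      field_simp
    rw [e4, e5]
    exact mul_le_mul_of_nonneg_right e3 (by positivity)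

/-- One step of the (damped) dynamics `x ↦ x - η D x` increases `x / D x` by about `η α`. -/
theorem inv_quot_increment (h : CriticalRV D α) {η : ℝ} (hη : 0 < η) (hη1 : η ≤ 1) :
    Tendsto (fun x => (x - η * D x) / D (x - η * D x) - x / D x) (𝓝[>] 0) (𝓝 (η * α)) := by
  have hε0 : Tendsto (fun x => η * (D x / x)) (𝓝[>] 0) (𝓝 0) := by
    simpa using h.quot_tendsto_zero.const_mul η
  have hε : Tendsto (fun x => η * (D x / x)) (𝓝[>] 0) (𝓝[>] 0) := by
    refine tendsto_nhdsWithin_iff.2 ⟨hε0, ?_⟩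
    filter_upwards [Ioc_mem_nhdsGT one_pos] with x hx
    exact mul_pos hη (h.quot_pos hx)
  have hs := h.slope_tendsto hε
  have hK : Tendsto (fun x => D ((1 - η * (D x / x)) * x) / D x) (𝓝[>] 0) (𝓝 1) := by
    have h1 := (hs.mul hε0).const_sub 1
    rw [mul_zero, sub_zero] at h1
    refine h1.congr' ?_
    filter_upwards [hε.eventually self_mem_nhdsWithin] with x hx
    rw [div_mul_cancel₀ _ (ne_of_gt hx)]
    ring
  have h2 := ((hs.sub_const 1).const_mul η).div hK one_ne_zero
  have h3 : η * (1 + α - 1) / 1 = η * α := by ring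
  rw [h3] at h2
  refine h2.congr' ?_
  filter_upwards [Ioc_mem_nhdsGT one_pos] with x hx
  have hx0 := hx.1
  have hD := h.pos hx
  have hlt := h.lt_self hx
  have hle : η * D x < x := by nlinarith
  have hD' : 0 < D (x - η * D x) := h.pos ⟨by linarith, by nlinarith [hx.2]⟩
  have e1 : (1 - η * (D x / x)) * x = x - η * D x := by field_simp
  simp only [Pi.div_apply, e1]
  field_simp
  ring

theorem continuousOn (h : CriticalRV D α) : ContinuousOn D (Set.Icc 0 1) := by
  have : ∀ x ∈ Set.Icc (0 : ℝ) 1, ∀ y ∈ Set.Icc (0 : ℝ) 1, x ≤ y → |D y - D x| ≤ y - x := by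
    intro x hx y hy hxy
    have h1 := h.mono_sub hx hy hxy
    simp only at h1
    rw [abs_le]
    refine ⟨?_, by linarith⟩
    have h2 : D x ≤ D y := by
      rcases hx.1.eq_or_lt with h0 | h0
      · rw [← h0, h.zero]; exact h.nonneg y hy
      · exact h.mono ⟨h0, hx.2⟩ ⟨h0.trans_le hxy, hy.2⟩ hxy
    linarith
  have hL : LipschitzOnWith 1 D (Set.Icc 0 1) := by
    refine LipschitzOnWith.of_dist_le_mul fun x hx y hy => ?_
    rw [NNReal.coe_one, one_mul, Real.dist_eq, Real.dist_eq]
    rcases le_total x y with hxy | hxy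
    · rw [abs_sub_comm, abs_sub_comm x y, abs_of_nonneg (sub_nonneg.2 hxy)]
      exact this x hx y hy hxy
    · rw [abs_of_nonneg (sub_nonneg.2 hxy)]
      exact this y hy x hx hxy
  exact hL.continuousOn

theorem exists_eq (h : CriticalRV D α) {b : ℝ} (hb : 0 < b) (hb1 : b ≤ D 1) :
    ∃ y ∈ Set.Ioc (0 : ℝ) 1, D y = b := by
  obtain ⟨y, hy, hyb⟩ := intermediate_value_Icc zero_le_one h.continuousOn
    (show b ∈ Set.Icc (D 0) (D 1) from ⟨by rw [h.zero]; exact hb.le, hb1⟩)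
  refine ⟨y, ⟨lt_of_le_of_ne hy.1 ?_, hy.2⟩, hyb⟩
  rintro rfl
  rw [h.zero] at hyb
  exact hb.ne hyb

theorem tendsto_zero_of_antitone (h : CriticalRV D α) {u e : ℕ → ℝ} (hu : Antitone u)
    (hu0 : ∀ n, u n ∈ Set.Icc (0 : ℝ) 1) (he : Tendsto e atTop (𝓝 0))
    (hstep : ∀ n, u (n + 1) ≤ u n - D (u n) + e n) : Tendsto u atTop (𝓝 0) := by
  have hbdd : BddBelow (Set.range u) := ⟨0, by rintro _ ⟨n, rfl⟩; exact (hu0 n).1⟩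
  have hl := tendsto_atTop_ciInf hu hbdd
  set l := ⨅ n, u n
  have hle : ∀ n, l ≤ u n := fun n => ciInf_le hbdd n
  rcases (le_ciInf fun n => (hu0 n).1 : 0 ≤ l).eq_or_lt with h0 | h0
  · rwa [show l = 0 from h0.symm] at hl
  · exfalso
    have h1 : Tendsto (fun n => u n - D l + e n) atTop (𝓝 (l - D l + 0)) :=
      (hl.sub_const _).add he
    have h2 : l ≤ l - D l + 0 := by
      refine le_of_tendsto_of_tendsto' (hl.comp (tendsto_add_atTop_nat 1)) h1 fun n => ?_
      have := h.mono ⟨h0, (hle n).trans (hu0 n).2⟩ ⟨h0.trans_le (hle n), (hu0 n).2⟩ (hle n)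
      have := hstep n
      simp only [Function.comp]
      linarith
    have := h.pos (x := l) ⟨h0, (hle 0).trans (hu0 0).2⟩
    linarith

/-- Uniform control of `x / D x` along orbits of `x ↦ x - D x` started near `0`. -/
theorem orbit_estimate (h : CriticalRV D α) {ε : ℝ} (hε : 0 < ε) :
    ∃ δ > 0, ∀ x : ℕ → ℝ, (∀ k, 0 < x k) → (∀ k, x (k + 1) = x k - D (x k)) →
      Antitone x → x 0 < δ → ∀ k : ℕ, |x k / D (x k) - x 0 / D (x 0) - α * k| ≤ ε * k := by
  have h1 := h.inv_quot_increment one_pos le_rfl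
  rw [one_mul] at h1
  obtain ⟨δ, hδ, hδ'⟩ := mem_nhdsGT_iff_exists_Ioo_subset.1
    (h1.eventually (Metric.ball_mem_nhds α hε))
  refine ⟨δ, hδ, fun x hx hstep hanti h0 k => ?_⟩
  induction k with
  | zero => simp
  | succ k ih =>
    have h2 := hδ' (show x k ∈ Set.Ioo 0 δ from ⟨hx k, (hanti (Nat.zero_le k)).trans_lt h0⟩)
    simp only [Set.mem_ofPred_eq, Real.dist_eq, one_mul, ← hstep] at h2
    push_cast
    rw [abs_le] at ih ⊢
    rw [abs_lt] at h2
    constructor <;> nlinarith [ih.1, ih.2, h2.1, h2.2]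

/-- Along an orbit of `x ↦ x - D x`, the quantity `x / D x` grows like `α n`. -/
theorem orbit_asymptotics (h : CriticalRV D α) {x : ℕ → ℝ} (hx : ∀ k, 0 < x k)
    (hstep : ∀ k, x (k + 1) = x k - D (x k)) (hlim : Tendsto x atTop (𝓝 0)) :
    Tendsto (fun n : ℕ => x n / D (x n) / n) atTop (𝓝 α) := by
  have h1 := h.inv_quot_increment one_pos le_rfl
  simp only [one_mul] at h1
  have h2 := h1.comp (tendsto_nhdsWithin_iff.2 ⟨hlim, Eventually.of_forall hx⟩)
  have h3 : Tendsto (fun n => x (n + 1) / D (x (n + 1)) - x n / D (x n)) atTop (𝓝 α) := by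
    refine h2.congr fun n => ?_
    simp only [Function.comp, ← hstep]
  have h4 := h3.cesaro
  have h5 : Tendsto (fun n : ℕ => (n : ℝ)⁻¹ * (x 0 / D (x 0))) atTop (𝓝 0) := by
    simpa using tendsto_inv_atTop_nhds_zero_nat.mul_const (x 0 / D (x 0))
  have h6 := h4.add h5
  rw [add_zero] at h6
  refine h6.congr fun n => ?_
  rw [Finset.sum_range_sub (fun n => x n / D (x n))]
  ring

end CriticalRV

theorem zero_mem_unit : (0 : ℝ) ∈ Set.Icc (0 : ℝ) 1 := ⟨le_rfl, zero_le_one⟩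

theorem one_mem_unit : (1 : ℝ) ∈ Set.Icc (0 : ℝ) 1 := ⟨zero_le_one, le_rfl⟩

section GeneratingFunction

variable {Ω : Type*} [MeasurableSpace Ω] (μ : Measure Ω)

theorem integrable_of_integral_pos {f : Ω → ℝ} (h : 0 < ∫ ω, f ω ∂μ) : Integrable f μ := by
  by_contra hcon
  rw [integral_undef hcon] at h
  exact lt_irrefl _ h

variable [IsProbabilityMeasure μ]

theorem integrable_pow_mul_pow {Z W : Ω → ℕ} (hZ : Measurable Z) (hW : Measurable W)
    {s t : ℝ} (hs : s ∈ Set.Icc (0 : ℝ) 1) (ht : t ∈ Set.Icc (0 : ℝ) 1) :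
    Integrable (fun ω => s ^ Z ω * t ^ W ω) μ := by
  refine Integrable.of_bound (C := 1) ?_ (Eventually.of_forall fun ω => ?_)
  · have h1 : Measurable fun ω => s ^ Z ω :=
      (measurable_of_countable (fun k : ℕ => s ^ k)).comp hZ
    have h2 : Measurable fun ω => t ^ W ω :=
      (measurable_of_countable (fun k : ℕ => t ^ k)).comp hW
    exact (h1.mul h2).aestronglyMeasurable
  · rw [Real.norm_eq_abs, abs_of_nonneg (mul_nonneg (pow_nonneg hs.1 _) (pow_nonneg ht.1 _))]
    exact mul_le_one₀ (pow_le_one₀ hs.1 hs.2) (pow_nonneg ht.1 _) (pow_le_one₀ ht.1 ht.2)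

theorem integrable_pow_nat {Z : Ω → ℕ} (hZ : Measurable Z) {s : ℝ} (hs : s ∈ Set.Icc (0 : ℝ) 1) :
    Integrable (fun ω => s ^ Z ω) μ := by
  simpa using integrable_pow_mul_pow μ hZ hZ hs (t := 1) ⟨zero_le_one, le_rfl⟩

/-- A critical offspring generating function of the form `s + (1 - s) ^ (1 + α) L (1 - s)` with `L`
slowly varying gives rise to a `CriticalRV` function. -/
theorem criticalRV_of_generatingFunction {Z : Ω → ℕ} (hZ : Measurable Z)
    (hmean : ∫ ω, (Z ω : ℝ) ∂μ = 1) {α : ℝ} (hα : 0 < α) {L : ℝ → ℝ}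
    (hF : ∀ s : ℝ, 0 ≤ s → s < 1 → ∫ ω, s ^ Z ω ∂μ = s + (1 - s) ^ (1 + α) * L (1 - s))
    (hL : ∀ c : ℝ, 0 < c → Tendsto (fun x => L (c * x) / L x) (𝓝[>] 0) (𝓝 1)) :
    CriticalRV (fun x => ∫ ω, (1 - x) ^ Z ω ∂μ - (1 - x)) α := by
  have hint : Integrable (fun ω => (Z ω : ℝ)) μ :=
    integrable_of_integral_pos μ (by rw [hmean]; exact one_pos)
  have hpow : ∀ x ∈ Set.Icc (0 : ℝ) 1, Integrable (fun ω => (1 - x) ^ Z ω) μ := fun x hx =>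
    integrable_pow_nat μ hZ ⟨by linarith [hx.2], by linarith [hx.1]⟩
  refine ⟨⟨convex_Icc 0 1, ?_⟩, by simp, ?_, ?_, ?_, hα, ?_⟩
  · intro x hx y hy a b ha hb hab
    have hxy : a • x + b • y ∈ Set.Icc (0 : ℝ) 1 := convex_Icc (0 : ℝ) 1 hx hy ha hb hab
    have h1 : ∫ ω, (1 - (a • x + b • y)) ^ Z ω ∂μ
        ≤ ∫ ω, (a * (1 - x) ^ Z ω + b * (1 - y) ^ Z ω) ∂μ := by
      refine integral_mono (hpow _ hxy) (((hpow x hx).const_mul a).add ((hpow y hy).const_mul b))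
        fun ω => ?_
      have h2 := (convexOn_pow (𝕜 := ℝ) (Z ω)).2 (x := 1 - x) (by simpa using hx.2)
        (y := 1 - y) (by simpa using hy.2) ha hb hab
      simp only [smul_eq_mul] at h2 ⊢
      convert h2 using 2
      linear_combination (-1 : ℝ) * hab
    rw [integral_add ((hpow x hx).const_mul a) ((hpow y hy).const_mul b),
      integral_const_mul, integral_const_mul] at h1
    simp only [smul_eq_mul] at h1 ⊢
    linear_combination h1 + hab
  · intro x hx
    have h1 : ∫ ω, (1 - (Z ω : ℝ) * x) ∂μ ≤ ∫ ω, (1 - x) ^ Z ω ∂μ := by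
      refine integral_mono ((integrable_const 1).sub (hint.mul_const x)) (hpow x hx) fun ω => ?_
      have := one_add_mul_le_pow (a := -x) (by linarith [hx.2]) (Z ω)
      simp only
      calc 1 - (Z ω : ℝ) * x = 1 + Z ω * -x := by ring
        _ ≤ (1 + -x) ^ Z ω := this
        _ = _ := by ring
    rw [integral_sub (integrable_const 1) (hint.mul_const x), integral_mul_const, hmean] at h1
    simp at h1
    linarith
  · have h0 : ∀ ω, 0 ≤ 1 - (1 - 1 : ℝ) ^ Z ω := fun ω => by
      rw [sub_nonneg]; exact pow_le_one₀ (by norm_num) (by norm_num)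
    have hi := hpow 1 ⟨zero_le_one, le_rfl⟩
    have h1 : 0 ≤ ∫ ω, (1 - (1 - 1 : ℝ) ^ Z ω) ∂μ := integral_nonneg h0
    have h2 : ∫ ω, (1 - (1 - 1 : ℝ) ^ Z ω) ∂μ ≠ 0 := by
      intro h
      rw [integral_eq_zero_iff_of_nonneg h0 ((integrable_const 1).sub hi)] at h
      have : ∫ ω, (Z ω : ℝ) ∂μ = 0 := by
        refine integral_eq_zero_of_ae ?_
        filter_upwards [h] with ω hω
        simp only [sub_self, Pi.zero_apply] at hω ⊢
        by_contra hne
        rw [zero_pow (by exact_mod_cast hne)] at hω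
        norm_num at hω
      rw [hmean] at this
      exact one_ne_zero this
    have h3 := lt_of_le_of_ne h1 h2.symm
    rw [integral_sub (integrable_const 1) hi] at h3
    simp at h3 ⊢
    exact h3
  · intro x hx y hy hxy
    have h1 : ∫ ω, (1 - y) ^ Z ω ∂μ ≤ ∫ ω, (1 - x) ^ Z ω ∂μ :=
      integral_mono (hpow y hy) (hpow x hx) fun ω =>
        pow_le_pow_left₀ (by linarith [hy.2]) (by linarith) _
    simp only
    linarith
  · intro c hc
    have h1 := (hL c hc).const_mul (c ^ (1 + α))
    rw [mul_one] at h1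
    refine h1.congr' ?_
    have hform : ∀ x ∈ Set.Ioc (0 : ℝ) 1, ∫ ω, (1 - x) ^ Z ω ∂μ - (1 - x)
        = x ^ (1 + α) * L x := fun x hx => by
      rw [hF (1 - x) (by linarith [hx.2]) (by linarith [hx.1]), sub_sub_cancel]
      ring
    filter_upwards [Ioc_mem_nhdsGT one_pos, Ioc_mem_nhdsGT (inv_pos.2 hc)] with x hx hxc
    have hcx : c * x ≤ 1 := by
      calc c * x ≤ c * c⁻¹ := mul_le_mul_of_nonneg_left hxc.2 hc.le
        _ = 1 := mul_inv_cancel₀ hc.ne'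
    rw [hform x hx, hform (c * x) ⟨mul_pos hc hx.1, hcx⟩, Real.mul_rpow hc.le hx.1.le]
    have := (Real.rpow_pos_of_pos hx.1 (1 + α)).ne'
    field_simp

theorem integral_zero_pow {Z : Ω → ℕ} (hZ : Measurable Z) : 1 - ∫ ω, (0 : ℝ) ^ Z ω ∂μ = (μ {ω | Z ω ≠ 0}).toReal := by
  have hm : MeasurableSet {ω | Z ω ≠ 0} := (hZ (measurableSet_singleton 0)).compl
  have h1 : ∀ ω, (0 : ℝ) ^ Z ω = 1 - Set.indicator {ω | Z ω ≠ 0} 1 ω := fun ω => by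
    by_cases h : Z ω = 0 <;> simp [h]
  simp_rw [h1]
  rw [integral_sub (integrable_const 1) ((integrable_const 1).indicator hm),
    integral_indicator_one hm]
  simp [Measure.real]

end GeneratingFunction

namespace GWSetup

variable (S : GWSetup)

instance : MeasurableSpace S.Ω := S.mΩ

instance : IsProbabilityMeasure S.P1 := S.hprob1

instance : IsProbabilityMeasure S.P2 := S.hprob2

/-- `F₁(1 - x) - (1 - x)`. -/
noncomputable def excess1 (x : ℝ) : ℝ := ∫ ω, (1 - x) ^ S.Z1 1 ω ∂S.P1 - (1 - x)

/-- `F₂₁(1, 1 - y) - (1 - y)`. -/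
noncomputable def excess2 (y : ℝ) : ℝ := ∫ ω, (1 - y) ^ S.Z2 1 ω ∂S.P2 - (1 - y)

theorem criticalRV_excess1 : CriticalRV S.excess1 S.α1 :=
  criticalRV_of_generatingFunction S.P1 (S.mZ1 1) S.hcrit1 S.hα1.1 S.hF1 S.hL1

theorem integral_pow_Z2 (s : ℝ) (h0 : 0 ≤ s) (h1 : s < 1) :
    ∫ ω, s ^ S.Z2 1 ω ∂S.P2 = s + (1 - s) ^ (1 + S.α2) * S.L2 (1 - s) := by
  simpa using S.hF2 1 s zero_le_one le_rfl h0 h1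

theorem criticalRV_excess2 : CriticalRV S.excess2 S.α2 :=
  criticalRV_of_generatingFunction S.P2 (S.mZ2 1) S.hcrit2 S.hα2.1 S.integral_pow_Z2 S.hL2

theorem F1_mem (n : ℕ) {s : ℝ} (hs : s ∈ Set.Icc (0 : ℝ) 1) : S.F1 n s ∈ Set.Icc (0 : ℝ) 1 := by
  refine ⟨integral_nonneg fun ω => pow_nonneg hs.1 _, ?_⟩
  have := integral_mono (integrable_pow_nat S.P1 (S.mZ1 n) hs) (integrable_const 1)
    fun ω => pow_le_one₀ hs.1 hs.2
  simpa [F1] using this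

theorem F21_mono (n : ℕ) {s t s' t' : ℝ} (hs : 0 ≤ s) (hss : s ≤ s') (hs' : s' ≤ 1)
    (ht : 0 ≤ t) (htt : t ≤ t') (ht' : t' ≤ 1) : S.F21 n s t ≤ S.F21 n s' t' :=
  integral_mono
    (integrable_pow_mul_pow S.P2 (S.mZ1 n) (S.mZ2 n) ⟨hs, hss.trans hs'⟩ ⟨ht, htt.trans ht'⟩)
    (integrable_pow_mul_pow S.P2 (S.mZ1 n) (S.mZ2 n) ⟨hs.trans hss, hs'⟩ ⟨ht.trans htt, ht'⟩)
    fun _ => mul_le_mul (pow_le_pow_left₀ hs hss _) (pow_le_pow_left₀ ht htt _)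
      (pow_nonneg ht _) (pow_nonneg (hs.trans hss) _)

theorem F21_mem (n : ℕ) {s t : ℝ} (hs : s ∈ Set.Icc (0 : ℝ) 1) (ht : t ∈ Set.Icc (0 : ℝ) 1) :
    S.F21 n s t ∈ Set.Icc (0 : ℝ) 1 := by
  refine ⟨integral_nonneg fun ω => mul_nonneg (pow_nonneg hs.1 _) (pow_nonneg ht.1 _), ?_⟩
  have := S.F21_mono n hs.1 hs.2 le_rfl ht.1 ht.2 le_rfl
  simpa [F21] using this

theorem Q1s_mem (n : ℕ) {s : ℝ} (hs : s ∈ Set.Icc (0 : ℝ) 1) : S.Q1s n s ∈ Set.Icc (0 : ℝ) 1 := by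
  have := S.F1_mem n hs
  exact ⟨by unfold Q1s; linarith [this.2], by unfold Q1s; linarith [this.1]⟩

theorem Q21s_mem (n : ℕ) {s t : ℝ} (hs : s ∈ Set.Icc (0 : ℝ) 1) (ht : t ∈ Set.Icc (0 : ℝ) 1) :
    S.Q21s n s t ∈ Set.Icc (0 : ℝ) 1 := by
  have := S.F21_mem n hs ht
  exact ⟨by unfold Q21s; linarith [this.2], by unfold Q21s; linarith [this.1]⟩

theorem Q1s_zero (s : ℝ) : S.Q1s 0 s = 1 - s := by
  have : ∫ ω, s ^ S.Z1 0 ω ∂S.P1 = ∫ _, s ∂S.P1 := integral_congr_ae <| by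
    filter_upwards [S.hinit1] with ω hω
    simp [hω.1]
  simp [Q1s, F1, this]

theorem Q21s_zero (s t : ℝ) : S.Q21s 0 s t = 1 - t := by
  have : ∫ ω, s ^ S.Z1 0 ω * t ^ S.Z2 0 ω ∂S.P2 = ∫ _, t ∂S.P2 := integral_congr_ae <| by
    filter_upwards [S.hinit2] with ω hω
    simp [hω.1, hω.2]
  simp [Q21s, F21, this]

theorem Q1s_add (m n : ℕ) {s : ℝ} (hs : s ∈ Set.Icc (0 : ℝ) 1) :
    S.Q1s (m + n) s = S.Q1s m (1 - S.Q1s n s) := by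
  have := S.hbranch1 m n s hs.1 hs.2
  simp only [Q1s, F1, sub_sub_cancel, this]

theorem Q21s_add (m n : ℕ) {s t : ℝ} (hs : s ∈ Set.Icc (0 : ℝ) 1) (ht : t ∈ Set.Icc (0 : ℝ) 1) :
    S.Q21s (m + n) s t = S.Q21s m (1 - S.Q1s n s) (1 - S.Q21s n s t) := by
  have := S.hbranch2 m n s t hs.1 hs.2 ht.1 ht.2
  simp only [Q21s, Q1s, F21, F1, sub_sub_cancel, this]

theorem Q1s_one (x : ℝ) : S.Q1s 1 (1 - x) = x - S.excess1 x := by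
  simp only [Q1s, F1, excess1]; ring

theorem Q1s_succ (n : ℕ) {s : ℝ} (hs : s ∈ Set.Icc (0 : ℝ) 1) :
    S.Q1s (n + 1) s = S.Q1s n s - S.excess1 (S.Q1s n s) := by
  rw [add_comm, S.Q1s_add 1 n hs, S.Q1s_one]

theorem Q21s_succ (n : ℕ) {s t : ℝ} (hs : s ∈ Set.Icc (0 : ℝ) 1) (ht : t ∈ Set.Icc (0 : ℝ) 1) :
    S.Q21s (n + 1) s t = S.Q21s 1 (1 - S.Q1s n s) (1 - S.Q21s n s t) := by
  rw [add_comm, S.Q21s_add 1 n hs ht]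

theorem Q21s_one_le {x y : ℝ} (hx : x ∈ Set.Icc (0 : ℝ) 1) (hy : y ∈ Set.Icc (0 : ℝ) 1) :
    S.Q21s 1 (1 - x) (1 - y) ≤ y - S.excess2 y + S.A21 * x := by
  have hint : Integrable (fun ω => (S.Z1 1 ω : ℝ)) S.P2 :=
    integrable_of_integral_pos S.P2 (by rw [S.hmean21]; exact S.hA21)
  have hx' : 1 - x ∈ Set.Icc (0 : ℝ) 1 := ⟨by linarith [hx.2], by linarith [hx.1]⟩
  have hy' : 1 - y ∈ Set.Icc (0 : ℝ) 1 := ⟨by linarith [hy.2], by linarith [hy.1]⟩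
  have i1 := integrable_pow_nat S.P2 (S.mZ2 1) hy'
  have h := integral_mono (i1.sub (hint.mul_const x))
    (integrable_pow_mul_pow S.P2 (S.mZ1 1) (S.mZ2 1) hx' hy') fun ω => by
      have h1 := one_add_mul_le_pow (a := -x) (by linarith [hx.2]) (S.Z1 1 ω)
      have h2 := pow_le_one₀ (n := S.Z2 1 ω) hy'.1 hy'.2
      have h3 := pow_nonneg hy'.1 (S.Z2 1 ω)
      have h4 : 0 ≤ (S.Z1 1 ω : ℝ) * x := mul_nonneg (Nat.cast_nonneg _) hx.1
      rw [← sub_eq_add_neg] at h1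
      simp only [Pi.sub_apply]
      nlinarith [mul_le_mul_of_nonneg_right h1 h3, mul_le_mul_of_nonneg_left h2 h4]
  simp only [Pi.sub_apply] at h
  rw [integral_sub i1 (hint.mul_const x), integral_mul_const, S.hmean21] at h
  simp only [Q21s, F21, excess2]
  linarith

theorem le_Q21s_one {x y : ℝ} (hx : x ∈ Set.Icc (0 : ℝ) 1) (hy : y ∈ Set.Icc (0 : ℝ) 1) :
    y - S.excess2 y ≤ S.Q21s 1 (1 - x) (1 - y) := by
  have := S.F21_mono 1 (s := 1 - x) (s' := 1) (t := 1 - y) (by linarith [hx.2]) (by linarith [hx.1])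
    le_rfl (by linarith [hy.2]) le_rfl (by linarith [hy.1])
  simp only [Q21s, F21, excess2, one_pow, one_mul] at this ⊢
  linarith

theorem exists_le_Q21s_one {ε : ℝ} (hε : 0 < ε) :
    ∃ δ > 0, ∀ x y : ℝ, x ∈ Set.Icc (0 : ℝ) 1 → y ∈ Set.Ioc (0 : ℝ) 1 → x < δ → y < δ →
      y - S.excess2 y + (S.A21 - ε) * x ≤ S.Q21s 1 (1 - x) (1 - y) := by
  obtain ⟨δ, hδ, H⟩ := S.hρ ε hε
  refine ⟨δ / 2, by positivity, fun x y hx hy hxδ hyδ => ?_⟩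
  have h1 := H (1 - x) (1 - y) (by linarith [hx.2]) (by linarith [hx.1]) (by linarith [hy.2])
    (by linarith [hy.1]) (by nlinarith [mul_nonneg hx.1 hy.1.le])
  have h2 := S.hF2 (1 - x) (1 - y) (by linarith [hx.2]) (by linarith [hx.1]) (by linarith [hy.2])
    (by linarith [hy.1])
  have h3 := S.integral_pow_Z2 (1 - y) (by linarith [hy.2]) (by linarith [hy.1])
  simp only [Q21s, F21, excess2, h2, h3, sub_sub_cancel]
  have h4 := (abs_lt.1 h1).2
  nlinarith [mul_le_mul_of_nonneg_right h4.le hx.1]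

theorem Q1_eq (n : ℕ) : S.Q1 n = S.Q1s n 0 :=
  (integral_zero_pow S.P1 (S.mZ1 n)).symm

theorem Q2_eq (n : ℕ) : S.Q2 n = S.Q21s n 1 0 := by
  simp only [Q21s, F21, one_pow, one_mul]
  exact (integral_zero_pow S.P2 (S.mZ2 n)).symm

theorem Q21_eq (n : ℕ) : S.Q21 n = S.Q21s n 0 0 := by
  have h := integral_zero_pow S.P2 ((S.mZ1 n).add (S.mZ2 n))
  simp only [Pi.add_apply, pow_add] at h
  rw [Q21s, F21, h, Q21, surv]
  congr 3
  ext ω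
  simp only [ne_eq, Nat.add_eq_zero_iff]
  tauto

theorem Q1s_antitone {s : ℝ} (hs : s ∈ Set.Icc (0 : ℝ) 1) : Antitone fun n => S.Q1s n s :=
  antitone_nat_of_succ_le fun n => by
    rw [S.Q1s_succ n hs]
    linarith [S.criticalRV_excess1.nonneg _ (S.Q1s_mem n hs)]

theorem Q1s_pos (n : ℕ) {s : ℝ} (hs : s ∈ Set.Ico (0 : ℝ) 1) : 0 < S.Q1s n s := by
  have hs' : s ∈ Set.Icc (0 : ℝ) 1 := ⟨hs.1, hs.2.le⟩
  induction n with
  | zero => rw [S.Q1s_zero]; linarith [hs.2]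
  | succ n ih =>
    rw [S.Q1s_succ n hs']
    linarith [S.criticalRV_excess1.lt_self ⟨ih, (S.Q1s_mem n hs').2⟩]

theorem Q21s_pos (n : ℕ) {s t : ℝ} (hs : s ∈ Set.Icc (0 : ℝ) 1) (ht : t ∈ Set.Ico (0 : ℝ) 1) :
    0 < S.Q21s n s t := by
  have ht' : t ∈ Set.Icc (0 : ℝ) 1 := ⟨ht.1, ht.2.le⟩
  induction n with
  | zero => rw [S.Q21s_zero]; linarith [ht.2]
  | succ n ih =>
    rw [S.Q21s_succ n hs ht']
    have := S.criticalRV_excess2.lt_self ⟨ih, (S.Q21s_mem n hs ht').2⟩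
    linarith [S.le_Q21s_one (S.Q1s_mem n hs) (S.Q21s_mem n hs ht')]

theorem Q21s_anti (n : ℕ) {s t s' t' : ℝ} (hs : 0 ≤ s) (hss : s ≤ s') (hs' : s' ≤ 1)
    (ht : 0 ≤ t) (htt : t ≤ t') (ht' : t' ≤ 1) : S.Q21s n s' t' ≤ S.Q21s n s t :=
  sub_le_sub_left (S.F21_mono n hs hss hs' ht htt ht') 1

theorem Q21s_zero_right_antitone {s : ℝ} (hs : s ∈ Set.Icc (0 : ℝ) 1) :
    Antitone fun n => S.Q21s n s 0 := by
  refine antitone_nat_of_succ_le fun n => ?_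
  have h1 := S.Q1s_mem 1 hs
  have h2 := S.Q21s_mem 1 hs zero_mem_unit
  rw [S.Q21s_add n 1 hs zero_mem_unit]
  have h3 : s ≤ 1 - S.Q1s 1 s := by
    have := S.Q1s_antitone hs zero_le_one
    simp only [S.Q1s_zero] at this
    linarith
  exact S.Q21s_anti n hs.1 h3 (by linarith [h1.1]) le_rfl (by linarith [h2.2]) (by linarith [h2.1])

theorem Q1_tendsto : Tendsto S.Q1 atTop (𝓝 0) := by
  have h : S.Q1 = fun n => S.Q1s n 0 := funext S.Q1_eq
  rw [h]
  refine S.criticalRV_excess1.tendsto_zero_of_antitone (e := fun _ => 0)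
    (S.Q1s_antitone zero_mem_unit) (fun n => S.Q1s_mem n zero_mem_unit) tendsto_const_nhds fun n => ?_
  rw [S.Q1s_succ n zero_mem_unit, add_zero]

theorem Q2_succ (n : ℕ) : S.Q2 (n + 1) = S.Q2 n - S.excess2 (S.Q2 n) := by
  have h : S.Q1s n 1 = 0 := by simp [Q1s, F1]
  rw [Q2_eq, S.Q21s_succ n one_mem_unit zero_mem_unit, h, ← Q2_eq]
  simp only [Q21s, F21, excess2, sub_zero, one_pow, one_mul]
  ring

theorem Q2_tendsto : Tendsto S.Q2 atTop (𝓝 0) := by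
  have h : S.Q2 = fun n => S.Q21s n 1 0 := funext S.Q2_eq
  refine S.criticalRV_excess2.tendsto_zero_of_antitone (e := fun _ => 0)
    (h ▸ S.Q21s_zero_right_antitone one_mem_unit)
    (fun n => S.Q2_eq n ▸ S.Q21s_mem n one_mem_unit zero_mem_unit) tendsto_const_nhds fun n => ?_
  rw [Q2_succ, add_zero]

theorem Q21_tendsto : Tendsto S.Q21 atTop (𝓝 0) := by
  have h : S.Q21 = fun n => S.Q21s n 0 0 := funext S.Q21_eq
  rw [h]
  have he : Tendsto (fun n => S.A21 * S.Q1s n 0) atTop (𝓝 0) := by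
    have := (S.Q1_tendsto).const_mul S.A21
    simpa only [S.Q1_eq, mul_zero] using this
  refine S.criticalRV_excess2.tendsto_zero_of_antitone
    (S.Q21s_zero_right_antitone zero_mem_unit) (fun n => S.Q21s_mem n zero_mem_unit zero_mem_unit)
    he fun n => ?_
  rw [S.Q21s_succ n zero_mem_unit zero_mem_unit]
  exact S.Q21s_one_le (S.Q1s_mem n zero_mem_unit) (S.Q21s_mem n zero_mem_unit zero_mem_unit)

/-- The generating function of the reduced process conditioned on survival. -/
theorem Ered_pow_eq {m n : ℕ} (hmn : m ≤ n) {s t : ℝ} (hs : s ∈ Set.Icc (0 : ℝ) 1)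
    (ht : t ∈ Set.Icc (0 : ℝ) 1) :
    S.Ered m n (fun k l => s ^ k * t ^ l) =
      1 - S.Q21s m (1 - (1 - s) * S.Q1 (n - m)) (1 - (1 - t) * S.Q21 (n - m)) / S.Q21 n := by
  have hm : MeasurableSet (S.surv n) := by
    have h1 : MeasurableSet {ω | S.Z1 n ω ≠ 0} := (S.mZ1 n (measurableSet_singleton 0)).compl
    have h2 : MeasurableSet {ω | S.Z2 n ω ≠ 0} := (S.mZ2 n (measurableSet_singleton 0)).compl
    exact h1.union h2
  have hint := integrable_pow_mul_pow S.P2 (S.mR1 m n) (S.mR2 m n) hs ht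
  have h1 := integral_add_compl hm hint
  have h2 : ∫ ω in (S.surv n)ᶜ, s ^ S.R1 m n ω * t ^ S.R2 m n ω ∂S.P2 = 1 - S.Q21 n := by
    have : ∫ ω in (S.surv n)ᶜ, s ^ S.R1 m n ω * t ^ S.R2 m n ω ∂S.P2
        = ∫ ω in (S.surv n)ᶜ, (1 : ℝ) ∂S.P2 := by
      refine setIntegral_congr_ae hm.compl ?_
      filter_upwards [S.hext m n] with ω hω hmem
      have h3 : S.Z1 n ω = 0 ∧ S.Z2 n ω = 0 := by
        simpa [surv] using hmem
      simp [hω h3]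
    rw [this]
    simp only [integral_const, smul_eq_mul, mul_one, MeasurableSet.univ, measureReal_restrict_apply,
      Set.univ_inter]
    exact probReal_compl_eq_one_sub hm
  have h3 := S.hreduced m n hmn s t hs.1 hs.2 ht.1 ht.2
  have h4 : 0 < S.Q21 n := by
    rw [S.Q21_eq]; exact S.Q21s_pos n zero_mem_unit ⟨le_rfl, one_pos⟩
  rw [Ered, eq_sub_iff_add_eq, ← add_div, div_eq_one_iff_eq h4.ne']
  have h5 : S.Q21s m (1 - (1 - s) * S.Q1 (n - m)) (1 - (1 - t) * S.Q21 (n - m))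
      = 1 - ∫ ω, s ^ S.R1 m n ω * t ^ S.R2 m n ω ∂S.P2 := by
    rw [h3]; rfl
  rw [h5]
  linarith

end GWSetup

namespace CriticalRV

variable {D : ℝ → ℝ} {α : ℝ}

theorem inv_quot_anti (h : CriticalRV D α) {x y : ℝ} (hx : x ∈ Set.Ioc (0 : ℝ) 1)
    (hy : y ∈ Set.Ioc (0 : ℝ) 1) (hxy : x ≤ y) : y / D y ≤ x / D x := by
  have h1 := h.quot_mono hx hy hxy
  have h2 := one_div_le_one_div_of_le (h.quot_pos hx) h1
  simpa only [one_div_div] using h2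

/-- If `y` follows the dynamics `y' ≤ y - D y + B` and ends above a level `Y` with
`D Y ≥ B / (1 - η)`, then `y / D y` has grown at least linearly. -/
theorem le_inv_quot_of_lt (h : CriticalRV D α) {y : ℕ → ℝ} {B Y η δ q : ℝ} {k₀ K : ℕ}
    (hη : η ∈ Set.Ioo (0 : ℝ) 1) (hY : Y ∈ Set.Ioc (0 : ℝ) 1) (hB : 0 ≤ B)
    (hYB : B ≤ (1 - η) * D Y)
    (hδ : ∀ z ∈ Set.Ioo 0 δ, q ≤ (z - η * D z) / D (z - η * D z) - z / D z)
    (hy : ∀ k, y k ∈ Set.Ioc (0 : ℝ) 1) (hyδ : ∀ k, y k < δ)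
    (hstep : ∀ k, k₀ ≤ k → y (k + 1) ≤ y k - D (y k) + B) (hK : Y < y (k₀ + K)) :
    K * q ≤ Y / D Y := by
  have hBY : B ≤ D Y := by nlinarith [hη.1, h.pos hY]
  have habove : ∀ j, j ≤ K → Y < y (k₀ + j) := by
    intro j hj
    by_contra hcon
    have : ∀ i, j ≤ i → y (k₀ + i) ≤ Y := by
      intro i hi
      induction i, hi using Nat.le_induction with
      | base => exact not_lt.1 hcon
      | succ i _ ih =>
        have h1 := hstep (k₀ + i) (Nat.le_add_right _ _)
        have h2 := h.mono_sub ⟨(hy (k₀ + i)).1.le, (hy (k₀ + i)).2⟩ ⟨hY.1.le, hY.2⟩ ih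
        simp only at h2
        rw [← add_assoc]
        linarith
    exact absurd (this K hj) (not_le.2 hK)
  have hgrow : ∀ j : ℕ, j ≤ K → j * q ≤ y (k₀ + j) / D (y (k₀ + j)) := by
    intro j
    induction j with
    | zero =>
      intro _
      simpa using (div_pos (hy k₀).1 (h.pos (hy k₀))).le
    | succ j ih =>
      intro hj
      have h1 := ih (by omega)
      have hyk := hy (k₀ + j)
      have h2 := hδ (y (k₀ + j)) ⟨hyk.1, hyδ _⟩
      have h3 := h.mono hY hyk (habove j (by omega)).le
      have h4 : y (k₀ + j + 1) ≤ y (k₀ + j) - η * D (y (k₀ + j)) := by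
        have := hstep (k₀ + j) (Nat.le_add_right _ _)
        nlinarith [hη.2]
      have h5 := h.lt_self hyk
      have h6 : y (k₀ + j) - η * D (y (k₀ + j)) ∈ Set.Ioc (0 : ℝ) 1 := by
        have := h.pos hyk
        constructor <;> nlinarith [hη.1, hη.2, hyk.2]
      have h7 := h.inv_quot_anti (hy (k₀ + j + 1)) h6 h4
      push_cast
      rw [← add_assoc]
      linarith
  exact (hgrow K le_rfl).trans (h.inv_quot_anti hY (hy _) hK.le)

/-- If `y` follows the dynamics `y' ≥ y - D y + B` and ends below a level `Y` with `D Y < B`, then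
`y` has grown at least linearly. -/
theorem linear_growth_of_lt (h : CriticalRV D α) {y : ℕ → ℝ} {B Y : ℝ} {K : ℕ}
    (hY : Y ∈ Set.Ioc (0 : ℝ) 1) (hYB : D Y ≤ B) (hy : ∀ k, y k ∈ Set.Ioc (0 : ℝ) 1)
    (hstep : ∀ k, k < K → y k - D (y k) + B ≤ y (k + 1)) (hK : y K < Y) :
    K * (B - D Y) ≤ Y := by
  have hbelow : ∀ j, j ≤ K → y j < Y := by
    intro j hj
    by_contra hcon
    have : ∀ i, j ≤ i → i ≤ K → Y ≤ y i := by
      intro i hi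
      induction i, hi using Nat.le_induction with
      | base => exact fun _ => not_lt.1 hcon
      | succ i _ ih =>
        intro hiK
        have h1 := hstep i (by omega)
        have h2 := h.mono_sub ⟨hY.1.le, hY.2⟩ ⟨(hy i).1.le, (hy i).2⟩ (ih (by omega))
        simp only at h2
        linarith
    exact absurd (this K hj le_rfl) (not_le.2 hK)
  have hgrow : ∀ j : ℕ, j ≤ K → j * (B - D Y) ≤ y j := by
    intro j
    induction j with
    | zero => intro _; simpa using (hy 0).1.le
    | succ j ih =>
      intro hj
      have h1 := ih (by omega)
      have h3 := h.mono (hy j) hY (hbelow j (by omega)).le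
      have h4 := hstep j (by omega)
      push_cast
      linarith
  exact (hgrow K le_rfl).trans hK.le

end CriticalRV

namespace GWSetup

variable (S : GWSetup)

theorem Q1_pos (n : ℕ) : 0 < S.Q1 n := by
  rw [Q1_eq]; exact S.Q1s_pos n ⟨le_rfl, one_pos⟩

theorem Q1_le_one (n : ℕ) : S.Q1 n ≤ 1 := by
  rw [Q1_eq]; exact (S.Q1s_mem n zero_mem_unit).2

theorem Q2_pos (n : ℕ) : 0 < S.Q2 n := by
  rw [Q2_eq]; exact S.Q21s_pos n one_mem_unit ⟨le_rfl, one_pos⟩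

theorem Q21_pos (n : ℕ) : 0 < S.Q21 n := by
  rw [Q21_eq]; exact S.Q21s_pos n zero_mem_unit ⟨le_rfl, one_pos⟩

theorem Q21_le_one (n : ℕ) : S.Q21 n ≤ 1 := by
  rw [Q21_eq]; exact (S.Q21s_mem n zero_mem_unit zero_mem_unit).2

theorem Q21_antitone : Antitone S.Q21 := by
  have h : S.Q21 = fun n => S.Q21s n 0 0 := funext S.Q21_eq
  rw [h]; exact S.Q21s_zero_right_antitone zero_mem_unit

theorem Q1_asymptotics :
    Tendsto (fun n : ℕ => S.Q1 n / S.excess1 (S.Q1 n) / n) atTop (𝓝 S.α1) :=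
  S.criticalRV_excess1.orbit_asymptotics S.Q1_pos
    (fun k => by simp only [Q1_eq]; exact S.Q1s_succ k zero_mem_unit) S.Q1_tendsto

theorem Q2_asymptotics :
    Tendsto (fun n : ℕ => S.Q2 n / S.excess2 (S.Q2 n) / n) atTop (𝓝 S.α2) :=
  S.criticalRV_excess2.orbit_asymptotics S.Q2_pos S.Q2_succ S.Q2_tendsto

/-- Under Condition (B), the relaxation time of the type-2 dynamics at any level `z` with
`excess2 z` at least of order `Q₁(n)` is `o(n)`. -/
theorem CondB.eventually_lt_mul_quot {S : GWSetup} (hB : S.CondB) {κ : ℝ} (hκ : 0 < κ) (M : ℝ) :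
    ∀ᶠ n : ℕ in atTop, ∀ z ∈ Set.Ioc (0 : ℝ) 1, κ * S.Q1 n ≤ S.excess2 z →
      M < n * (S.excess2 z / z) := by
  have hD := S.criticalRV_excess2
  have hα := S.hα2.1
  obtain ⟨K, hK, hK0⟩ := (((tendsto_rpow_atTop hα).eventually_gt_atTop (M * S.α2)).and
    (eventually_gt_atTop 0)).exists
  have hQ2 : Tendsto S.Q2 atTop (𝓝[>] 0) :=
    tendsto_nhdsWithin_iff.2 ⟨S.Q2_tendsto, Eventually.of_forall S.Q2_pos⟩
  have hKQ : Tendsto (fun n => K * S.Q2 n) atTop (𝓝 0) := by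
    simpa using S.Q2_tendsto.const_mul K
  have h1 := ((hD.quot_rv K hK0).comp hQ2).mul (S.Q2_asymptotics.inv₀ hα.ne')
  have h2 : Tendsto (fun n : ℕ => n * (S.excess2 (K * S.Q2 n) / (K * S.Q2 n))) atTop
      (𝓝 (K ^ S.α2 * S.α2⁻¹)) := by
    refine h1.congr' ?_
    filter_upwards [eventually_gt_atTop 0, S.Q2_tendsto.eventually (gt_mem_nhds one_pos)]
      with n hn hn1
    have := S.Q2_pos n
    have := hD.pos ⟨S.Q2_pos n, hn1.le⟩
    have : (0 : ℝ) < n := by exact_mod_cast hn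
    simp only [Function.comp]
    field_simp
  have h3 : M < K ^ S.α2 * S.α2⁻¹ := by rwa [← div_eq_mul_inv, lt_div_iff₀ hα]
  have h4 : Tendsto (fun n : ℕ => S.excess2 (K * S.Q2 n) / S.Q1 n) atTop (𝓝 0) := by
    have h5 := (hB.const_mul K).mul h2
    rw [mul_zero, zero_mul] at h5
    refine h5.congr' ?_
    filter_upwards [eventually_gt_atTop 0] with n hn
    have := S.Q2_pos n
    have := S.Q1_pos n
    have : (0 : ℝ) < n := by exact_mod_cast hn
    field_simp
  filter_upwards [h2.eventually (lt_mem_nhds h3), h4.eventually (gt_mem_nhds hκ),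
    hKQ.eventually (gt_mem_nhds one_pos)] with n h5 h6 h7 z hz hzκ
  have hKn : K * S.Q2 n ∈ Set.Ioc (0 : ℝ) 1 := ⟨mul_pos hK0 (S.Q2_pos n), h7.le⟩
  rw [div_lt_iff₀ (S.Q1_pos n)] at h6
  have h8 : K * S.Q2 n ≤ z := by
    by_contra hcon
    have := hD.mono hz hKn (not_le.1 hcon).le
    linarith
  exact h5.trans_le (mul_le_mul_of_nonneg_left (hD.quot_mono hKn hz h8) (Nat.cast_nonneg n))

/-- `Q₁` iterated `k` times from the initial condition `(1 - s) Q₁(n - ⌊a n⌋)`. -/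
noncomputable def reducedQ1 (a s : ℝ) (n k : ℕ) : ℝ :=
  S.Q1s k (1 - (1 - s) * S.Q1 (n - ⌊a * (n : ℝ)⌋₊))

/-- `Q₂₁` iterated `k` times from the initial condition
`((1 - s) Q₁(n - ⌊a n⌋), (1 - t) Q₂₁(n - ⌊a n⌋))`. -/
noncomputable def reducedQ21 (a s t : ℝ) (n k : ℕ) : ℝ :=
  S.Q21s k (1 - (1 - s) * S.Q1 (n - ⌊a * (n : ℝ)⌋₊)) (1 - (1 - t) * S.Q21 (n - ⌊a * (n : ℝ)⌋₊))

section Reduced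

variable {a s t : ℝ}

theorem one_sub_mul_Q1_mem (hs : s ∈ Set.Ico (0 : ℝ) 1) (n : ℕ) :
    1 - (1 - s) * S.Q1 n ∈ Set.Ico (0 : ℝ) 1 := by
  have := S.Q1_pos n
  have := S.Q1_le_one n
  constructor <;> nlinarith [hs.1, hs.2]

theorem one_sub_mul_Q21_mem (hs : s ∈ Set.Ico (0 : ℝ) 1) (n : ℕ) :
    1 - (1 - s) * S.Q21 n ∈ Set.Ico (0 : ℝ) 1 := by
  have := S.Q21_pos n
  have := S.Q21_le_one n
  constructor <;> nlinarith [hs.1, hs.2]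

theorem reducedQ1_pos (hs : s ∈ Set.Ico (0 : ℝ) 1) (n k : ℕ) : 0 < S.reducedQ1 a s n k :=
  S.Q1s_pos k (S.one_sub_mul_Q1_mem hs _)

theorem reducedQ1_antitone (hs : s ∈ Set.Ico (0 : ℝ) 1) (n : ℕ) : Antitone (S.reducedQ1 a s n) :=
  S.Q1s_antitone (Set.Ico_subset_Icc_self (S.one_sub_mul_Q1_mem hs _))

theorem reducedQ1_zero (n : ℕ) :
    S.reducedQ1 a s n 0 = (1 - s) * S.Q1 (n - ⌊a * (n : ℝ)⌋₊) := by
  rw [reducedQ1, Q1s_zero, sub_sub_cancel]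

theorem reducedQ1_mem (hs : s ∈ Set.Ico (0 : ℝ) 1) (n k : ℕ) :
    S.reducedQ1 a s n k ∈ Set.Icc (0 : ℝ) 1 :=
  S.Q1s_mem k (Set.Ico_subset_Icc_self (S.one_sub_mul_Q1_mem hs _))

theorem reducedQ1_succ (hs : s ∈ Set.Ico (0 : ℝ) 1) (n k : ℕ) :
    S.reducedQ1 a s n (k + 1) = S.reducedQ1 a s n k - S.excess1 (S.reducedQ1 a s n k) :=
  S.Q1s_succ k (Set.Ico_subset_Icc_self (S.one_sub_mul_Q1_mem hs _))

theorem reducedQ21_mem (hs : s ∈ Set.Ico (0 : ℝ) 1) (ht : t ∈ Set.Ico (0 : ℝ) 1) (n k : ℕ) :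
    S.reducedQ21 a s t n k ∈ Set.Ioc (0 : ℝ) 1 :=
  have h1 := Set.Ico_subset_Icc_self (S.one_sub_mul_Q1_mem hs (n - ⌊a * (n : ℝ)⌋₊))
  have h2 := S.one_sub_mul_Q21_mem ht (n - ⌊a * (n : ℝ)⌋₊)
  ⟨S.Q21s_pos k h1 h2, (S.Q21s_mem k h1 (Set.Ico_subset_Icc_self h2)).2⟩

theorem reducedQ21_succ (hs : s ∈ Set.Ico (0 : ℝ) 1) (ht : t ∈ Set.Ico (0 : ℝ) 1) (n k : ℕ) :
    S.reducedQ21 a s t n (k + 1) =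
      S.Q21s 1 (1 - S.reducedQ1 a s n k) (1 - S.reducedQ21 a s t n k) :=
  S.Q21s_succ k (Set.Ico_subset_Icc_self (S.one_sub_mul_Q1_mem hs _))
    (Set.Ico_subset_Icc_self (S.one_sub_mul_Q21_mem ht _))

theorem Q1s_one_sub_Q1 (m n : ℕ) : S.Q1s m (1 - S.Q1 n) = S.Q1 (m + n) := by
  simp only [Q1_eq]
  exact (S.Q1s_add m n zero_mem_unit).symm

theorem Q21s_one_sub_Q21 (m n : ℕ) : S.Q21s m (1 - S.Q1 n) (1 - S.Q21 n) = S.Q21 (m + n) := by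
  simp only [Q1_eq, Q21_eq]
  exact (S.Q21s_add m n zero_mem_unit zero_mem_unit).symm

theorem reducedQ21_le (hs : s ∈ Set.Ico (0 : ℝ) 1) (ht : t ∈ Set.Ico (0 : ℝ) 1) (n k : ℕ) :
    S.reducedQ21 a s t n k ≤ S.Q21 (n - ⌊a * (n : ℝ)⌋₊) := by
  set N := n - ⌊a * (n : ℝ)⌋₊ with hN
  have h1 := S.Q1_pos N
  have h2 := S.Q21_pos N
  refine le_trans ?_ (S.Q21_antitone (Nat.le_add_left N k))
  rw [← Q21s_one_sub_Q21]
  exact S.Q21s_anti k (by linarith [S.Q1_le_one N]) (by nlinarith [hs.1])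
    (S.one_sub_mul_Q1_mem hs N).2.le (by linarith [S.Q21_le_one N]) (by nlinarith [ht.1])
    (S.one_sub_mul_Q21_mem ht N).2.le

theorem tendsto_sub_floor_div (ha : a ∈ Set.Ioo (0 : ℝ) 1) :
    Tendsto (fun n : ℕ => ((n - ⌊a * (n : ℝ)⌋₊ : ℕ) : ℝ) / n) atTop (𝓝 (1 - a)) := by
  have h1 := ((tendsto_nat_floor_mul_div_atTop ha.1.le).comp
    (tendsto_natCast_atTop_atTop (R := ℝ))).const_sub 1
  refine h1.congr' ?_
  filter_upwards [eventually_gt_atTop 0] with n hn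
  have hn' : (0 : ℝ) < n := by exact_mod_cast hn
  have hle : ⌊a * (n : ℝ)⌋₊ ≤ n := Nat.floor_le_of_le (by nlinarith [ha.2])
  rw [Nat.cast_sub hle]
  simp only [Function.comp]
  field_simp

theorem tendsto_sub_floor (ha : a ∈ Set.Ioo (0 : ℝ) 1) :
    Tendsto (fun n : ℕ => n - ⌊a * (n : ℝ)⌋₊) atTop atTop := by
  have h1 := (tendsto_sub_floor_div ha).pos_mul_atTop (by linarith [ha.2])
    (tendsto_natCast_atTop_atTop (R := ℝ))
  refine tendsto_natCast_atTop_iff.1 (h1.congr' ?_)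
  filter_upwards [eventually_gt_atTop 0] with n hn
  have hn' : (n : ℝ) ≠ 0 := by exact_mod_cast hn.ne'
  rw [div_mul_cancel₀ _ hn']

theorem reducedQ1_tendsto_zero (ha : a ∈ Set.Ioo (0 : ℝ) 1) (hs : s ∈ Set.Ico (0 : ℝ) 1)
    (k : ℕ → ℕ) : Tendsto (fun n => S.reducedQ1 a s n (k n)) atTop (𝓝 0) := by
  have h1 := (S.Q1_tendsto.comp (tendsto_sub_floor ha)).const_mul (1 - s)
  rw [mul_zero] at h1
  refine squeeze_zero (fun n => (S.reducedQ1_pos hs n _).le) (fun n => ?_) h1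
  have := S.reducedQ1_antitone (a := a) hs n (Nat.zero_le (k n))
  rwa [reducedQ1_zero] at this

theorem reducedQ1_asymptotics (ha : a ∈ Set.Ioo (0 : ℝ) 1) (hs : s ∈ Set.Ico (0 : ℝ) 1)
    {b : ℝ} (hb : 0 ≤ b) :
    Tendsto (fun n : ℕ => S.reducedQ1 a s n ⌊b * (n : ℝ)⌋₊ / S.Q1 n) atTop
      (𝓝 (((1 - s) ^ (-S.α1) * (1 - a) + b)⁻¹ ^ (1 / S.α1))) := by
  have hD := S.criticalRV_excess1
  have hα := S.hα1.1
  have hs1 : 0 < 1 - s := by linarith [hs.2]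
  have ha1 : 0 < 1 - a := by linarith [ha.2]
  set c := (1 - s) ^ (-S.α1) * (1 - a) + b with hc
  have hc0 : 0 < c := add_pos_of_pos_of_nonneg (mul_pos (Real.rpow_pos_of_pos hs1 _) ha1) hb
  have hN := tendsto_sub_floor ha
  have hQN : Tendsto (fun n : ℕ => S.Q1 (n - ⌊a * (n : ℝ)⌋₊)) atTop (𝓝[>] 0) :=
    tendsto_nhdsWithin_iff.2 ⟨S.Q1_tendsto.comp hN, Eventually.of_forall fun n => S.Q1_pos _⟩
  have hx : ∀ n k, S.reducedQ1 a s n k ∈ Set.Ioc (0 : ℝ) 1 := fun n k =>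
    ⟨S.reducedQ1_pos hs n k, (S.reducedQ1_mem hs n k).2⟩
  -- the starting point
  have h0 : Tendsto (fun n => S.reducedQ1 a s n 0 / S.excess1 (S.reducedQ1 a s n 0) / n) atTop
      (𝓝 (((1 - s) ^ S.α1)⁻¹ * S.α1 * (1 - a))) := by
    have h1 := ((((hD.quot_rv (1 - s) hs1).comp hQN).inv₀
      (Real.rpow_pos_of_pos hs1 _).ne').mul (S.Q1_asymptotics.comp hN)).mul
      (tendsto_sub_floor_div ha)
    refine h1.congr' ?_
    filter_upwards [eventually_gt_atTop 0, hN.eventually_gt_atTop 0] with n hn hNn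
    have hn' : (0 : ℝ) < n := by exact_mod_cast hn
    have hN' : (0 : ℝ) < (n - ⌊a * (n : ℝ)⌋₊ : ℕ) := by exact_mod_cast hNn
    have e1 := hD.pos (hx n 0)
    rw [reducedQ1_zero] at e1 ⊢
    have e2 := S.Q1_pos (n - ⌊a * (n : ℝ)⌋₊)
    have e3 := hD.pos ⟨e2, S.Q1_le_one _⟩
    simp only [Function.comp]
    field_simp
  have hfl := (tendsto_nat_floor_mul_div_atTop hb).comp (tendsto_natCast_atTop_atTop (R := ℝ))
  have h2 := h0.add (hfl.const_mul S.α1)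
  have h3 : Tendsto (fun n : ℕ => S.reducedQ1 a s n ⌊b * (n : ℝ)⌋₊ /
      S.excess1 (S.reducedQ1 a s n ⌊b * (n : ℝ)⌋₊) / n) atTop (𝓝 (S.α1 * c)) := by
    have e0 : ((1 - s) ^ S.α1)⁻¹ * S.α1 * (1 - a) + S.α1 * b = S.α1 * c := by
      rw [hc, Real.rpow_neg hs1.le]; ring
    rw [e0] at h2
    refine tendsto_of_tendsto_of_dist h2 ?_
    rw [Metric.tendsto_atTop]
    intro ε hε
    have hb1 : 0 < b + 1 := by linarith
    obtain ⟨δ, hδ, H⟩ := hD.orbit_estimate (div_pos hε hb1)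
    have h4 := (S.reducedQ1_tendsto_zero ha hs (fun _ => 0)).eventually (gt_mem_nhds hδ)
    obtain ⟨n₀, hn₀⟩ := eventually_atTop.1 (h4.and (eventually_gt_atTop 0))
    refine ⟨n₀, fun n hn => ?_⟩
    obtain ⟨h5, h6⟩ := hn₀ n hn
    have hn' : (0 : ℝ) < n := by exact_mod_cast h6
    have h7 := H (S.reducedQ1 a s n) (S.reducedQ1_pos hs n) (S.reducedQ1_succ hs n)
      (S.reducedQ1_antitone hs n) h5 ⌊b * (n : ℝ)⌋₊
    have h8 : (⌊b * (n : ℝ)⌋₊ : ℝ) ≤ b * n := Nat.floor_le (by positivity)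
    rw [Real.dist_eq, sub_zero, abs_of_nonneg dist_nonneg, dist_comm, Real.dist_eq]
    simp only [Function.comp]
    have e1 : ∀ u v k : ℝ, u / n - (v / n + S.α1 * (k / n)) = (u - v - S.α1 * k) / n := by
      intros; ring
    rw [e1, abs_div, abs_of_pos hn', div_lt_iff₀ hn']
    refine h7.trans_lt ?_
    calc ε / (b + 1) * (⌊b * (n : ℝ)⌋₊ : ℝ) ≤ ε / (b + 1) * (b * n) :=
          mul_le_mul_of_nonneg_left h8 (div_pos hε hb1).le
      _ = (b / (b + 1)) * (ε * n) := by ring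
      _ < 1 * (ε * n) := by
          refine mul_lt_mul_of_pos_right ?_ (mul_pos hε hn')
          rw [div_lt_one hb1]; linarith
      _ = ε * n := one_mul _
  refine tendsto_div_of_regularlyVarying hα hD.quot_mono (fun x hx => hD.quot_pos hx) hD.quot_rv
    (Eventually.of_forall fun n => hx n _)
    (tendsto_nhdsWithin_iff.2 ⟨S.Q1_tendsto, Eventually.of_forall S.Q1_pos⟩) (inv_pos.2 hc0) ?_
  have h9 := S.Q1_asymptotics.div h3 (mul_pos hα hc0).ne'
  have e2 : S.α1 / (S.α1 * c) = c⁻¹ := by field_simp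
  rw [e2] at h9
  refine h9.congr' ?_
  filter_upwards [eventually_gt_atTop 0] with n hn
  have hn' : (0 : ℝ) < n := by exact_mod_cast hn
  have e3 := (hx n ⌊b * (n : ℝ)⌋₊).1
  have e4 := hD.pos (hx n ⌊b * (n : ℝ)⌋₊)
  have e5 := S.Q1_pos n
  have e6 := hD.pos ⟨e5, S.Q1_le_one n⟩
  simp only [Pi.div_apply]
  field_simp

end Reduced

end GWSetup

namespace GWSetup

variable {S : GWSetup} {a s t : ℝ}

theorem CondB.eventually_excess2_le (hB : S.CondB) (ha : a ∈ Set.Ioo (0 : ℝ) 1)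
    (hs : s ∈ Set.Ico (0 : ℝ) 1) (ht : t ∈ Set.Ico (0 : ℝ) 1) {r : ℝ} (hr : S.A21 < r) :
    ∀ᶠ n : ℕ in atTop, S.excess2 (S.reducedQ21 a s t n ⌊a * (n : ℝ)⌋₊)
      ≤ r * S.reducedQ1 a s n ⌊a * (n : ℝ)⌋₊ := by
  have hD := S.criticalRV_excess2
  have hα := S.hα1.1
  have hA := S.hA21
  have hs1 : 0 < 1 - s := by linarith [hs.2]
  obtain ⟨r', hr1, hr2⟩ := exists_between hr
  have hr'0 : 0 < r' := hA.trans hr1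
  have hp : 0 < (1 - s) ^ (-S.α1) * (1 - a) :=
    mul_pos (Real.rpow_pos_of_pos hs1 _) (by linarith [ha.2])
  set φ : ℝ → ℝ := fun b => ((1 - s) ^ (-S.α1) * (1 - a) + b)⁻¹ ^ (1 / S.α1) with hφ
  have hφpos : ∀ b, 0 < b → 0 < φ b := fun b hb => Real.rpow_pos_of_pos (by positivity) _
  have hφc : ContinuousAt φ a := by
    have hne : (1 - s) ^ (-S.α1) * (1 - a) + a ≠ 0 := (add_pos hp ha.1).ne'
    exact ((continuousAt_const.add continuousAt_id).inv₀ hne).rpow_const (Or.inl (inv_ne_zero hne))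
  -- an earlier time at which the type-1 component is nearly the same
  obtain ⟨b, hb, hb0, hba⟩ : ∃ b, φ b < r / r' * φ a ∧ 0 < b ∧ b < a := by
    have h1 : φ a < r / r' * φ a := by
      have : 1 < r / r' := (one_lt_div hr'0).2 hr2
      nlinarith [hφpos a ha.1]
    have h2 := (hφc.tendsto.mono_left (nhdsWithin_le_nhds (s := Set.Iio a))).eventually
      (gt_mem_nhds h1)
    obtain ⟨b, h3, h4⟩ := (h2.and (Ioo_mem_nhdsLT ha.1)).exists
    exact ⟨b, h3, h4.1, h4.2⟩
  have hXb := S.reducedQ1_asymptotics ha hs hb0.le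
  have hXa := S.reducedQ1_asymptotics ha hs ha.1.le
  have hXba := hXb.eventually_lt (hXa.const_mul (r / r')) hb
  set η := 1 - S.A21 / r' with hη_def
  have hη : η ∈ Set.Ioo (0 : ℝ) 1 := by
    have h1 : S.A21 / r' < 1 := (div_lt_one hr'0).2 hr1
    have h2 : 0 < S.A21 / r' := div_pos hA hr'0
    constructor <;> linarith
  set q := η * S.α2 / 2 with hq_def
  have hηα : 0 < η * S.α2 := mul_pos hη.1 S.hα2.1
  obtain ⟨δ, hδ, hδ'⟩ := mem_nhdsGT_iff_exists_Ioo_subset.1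
    ((hD.inv_quot_increment hη.1 hη.2.le).eventually (lt_mem_nhds (half_lt_self hηα)))
  have hκ : 0 < r' * (φ b / 2) := mul_pos hr'0 (half_pos (hφpos b hb0))
  have hab : 0 < a - b := by linarith
  have hq : 0 < q := half_pos hηα
  have hfl : ∀ c : ℝ, 0 ≤ c → Tendsto (fun n : ℕ => (⌊c * (n : ℝ)⌋₊ : ℝ) / n) atTop (𝓝 c) :=
    fun c hc => (tendsto_nat_floor_mul_div_atTop hc).comp (tendsto_natCast_atTop_atTop (R := ℝ))
  have hwin := ((hfl a ha.1.le).sub (hfl b hb0.le)).eventually (lt_mem_nhds (half_lt_self hab))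
  have hsmall : ∀ᶠ n : ℕ in atTop, r' * S.reducedQ1 a s n ⌊b * (n : ℝ)⌋₊ < S.excess2 1 := by
    have h1 := (S.reducedQ1_tendsto_zero ha hs (fun n => ⌊b * (n : ℝ)⌋₊)).const_mul r'
    rw [mul_zero] at h1
    exact h1.eventually (gt_mem_nhds (hD.pos ⟨one_pos, le_rfl⟩))
  filter_upwards [hXba, hXb.eventually (lt_mem_nhds (half_lt_self (hφpos b hb0))),
    hB.eventually_lt_mul_quot hκ (((a - b) / 2 * q)⁻¹), hwin, hsmall, eventually_gt_atTop 0,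
    (S.Q21_tendsto.comp (tendsto_sub_floor ha)).eventually (gt_mem_nhds hδ)]
    with n h1 h2 h3 h4 h5 hn h6
  have hn' : (0 : ℝ) < n := by exact_mod_cast hn
  have hQ1 := S.Q1_pos n
  set k₀ := ⌊b * (n : ℝ)⌋₊ with hk₀
  set m := ⌊a * (n : ℝ)⌋₊ with hm
  have hk₀m : k₀ ≤ m := Nat.floor_le_floor (mul_le_mul_of_nonneg_right hba.le hn'.le)
  have hXpos : 0 < S.reducedQ1 a s n k₀ := S.reducedQ1_pos hs n k₀
  obtain ⟨Y, hY, hYeq⟩ := hD.exists_eq (mul_pos hr'0 hXpos) h5.le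
  have hXX : r' * S.reducedQ1 a s n k₀ ≤ r * S.reducedQ1 a s n m := by
    rw [← mul_div_assoc, div_lt_div_iff_of_pos_right hQ1, div_mul_eq_mul_div,
      lt_div_iff₀ hr'0] at h1
    linarith
  rw [lt_div_iff₀ hQ1] at h2
  rcases le_or_gt (S.reducedQ21 a s t n m) Y with hle | hgt
  · have := hD.mono (S.reducedQ21_mem hs ht n m) hY hle
    linarith
  · exfalso
    have h7 := hD.le_inv_quot_of_lt (y := S.reducedQ21 a s t n)
      (B := S.A21 * S.reducedQ1 a s n k₀) (k₀ := k₀) (K := m - k₀) (δ := δ) (q := q) hη hY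
      (mul_pos hA hXpos).le
      (by rw [hYeq, hη_def, sub_sub_cancel, ← mul_assoc, div_mul_cancel₀ _ hr'0.ne'])
      (fun z hz => (hδ' hz).le) (S.reducedQ21_mem hs ht n)
      (fun k => (S.reducedQ21_le hs ht n k).trans_lt h6)
      (fun k hk => by
        rw [S.reducedQ21_succ hs ht]
        have h8 := S.reducedQ21_mem (a := a) hs ht n k
        refine (S.Q21s_one_le (S.reducedQ1_mem hs n k) ⟨h8.1.le, h8.2⟩).trans ?_
        have := mul_le_mul_of_nonneg_left (S.reducedQ1_antitone (a := a) hs n hk) hA.le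
        linarith)
      (by rwa [Nat.add_sub_cancel' hk₀m])
    have h9 := h3 Y hY (by rw [hYeq]; nlinarith)
    rw [Nat.cast_sub hk₀m] at h7
    rw [← sub_div, lt_div_iff₀ hn'] at h4
    have hDY := hD.pos hY
    have hY0 := hY.1
    have h10 : (a - b) / 2 * n * q < Y / S.excess2 Y :=
      (mul_lt_mul_of_pos_right h4 hq).trans_le h7
    have h11 : Y / S.excess2 Y < (a - b) / 2 * q * n := by
      rw [inv_lt_iff_one_lt_mul₀ (by positivity)] at h9
      rw [div_lt_iff₀ hDY]
      calc Y = Y * 1 := (mul_one Y).symm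
        _ < Y * (n * (S.excess2 Y / Y) * ((a - b) / 2 * q)) := mul_lt_mul_of_pos_left h9 hY0
        _ = _ := by field_simp
    linarith

theorem CondB.eventually_le_excess2 (hB : S.CondB) (ha : a ∈ Set.Ioo (0 : ℝ) 1)
    (hs : s ∈ Set.Ico (0 : ℝ) 1) (ht : t ∈ Set.Ico (0 : ℝ) 1) {r : ℝ} (hr0 : 0 < r)
    (hr : r < S.A21) :
    ∀ᶠ n : ℕ in atTop, r * S.reducedQ1 a s n ⌊a * (n : ℝ)⌋₊
      ≤ S.excess2 (S.reducedQ21 a s t n ⌊a * (n : ℝ)⌋₊) := by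
  have hD := S.criticalRV_excess2
  have hs1 : 0 < 1 - s := by linarith [hs.2]
  obtain ⟨r', hr1, hr2⟩ := exists_between hr
  have hφ : 0 < ((1 - s) ^ (-S.α1) * (1 - a) + a)⁻¹ ^ (1 / S.α1) :=
    Real.rpow_pos_of_pos (inv_pos.2 (add_pos
      (mul_pos (Real.rpow_pos_of_pos hs1 _) (by linarith [ha.2])) ha.1)) _
  have hXa := S.reducedQ1_asymptotics ha hs ha.1.le
  set φ := ((1 - s) ^ (-S.α1) * (1 - a) + a)⁻¹ ^ (1 / S.α1)
  obtain ⟨δ, hδ, Hδ⟩ := S.exists_le_Q21s_one (sub_pos.2 hr2)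
  have hκ : 0 < r * (φ / 2) := mul_pos hr0 (half_pos hφ)
  have hfl := (tendsto_nat_floor_mul_div_atTop ha.1.le).comp
    (tendsto_natCast_atTop_atTop (R := ℝ))
  have hX0 : ∀ k : ℕ → ℕ, Tendsto (fun n => S.reducedQ1 a s n (k n)) atTop (𝓝 0) :=
    S.reducedQ1_tendsto_zero ha hs
  have hsmall : ∀ᶠ n : ℕ in atTop, r * S.reducedQ1 a s n ⌊a * (n : ℝ)⌋₊ < S.excess2 1 := by
    have h1 := (hX0 (fun n => ⌊a * (n : ℝ)⌋₊)).const_mul r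
    rw [mul_zero] at h1
    exact h1.eventually (gt_mem_nhds (hD.pos ⟨one_pos, le_rfl⟩))
  filter_upwards [hXa.eventually (lt_mem_nhds (half_lt_self hφ)),
    hB.eventually_lt_mul_quot hκ (r / (a / 2 * (r' - r))),
    hfl.eventually (lt_mem_nhds (half_lt_self ha.1)), hsmall, eventually_gt_atTop 0,
    (S.Q21_tendsto.comp (tendsto_sub_floor ha)).eventually (gt_mem_nhds hδ),
    (hX0 fun _ => 0).eventually (gt_mem_nhds hδ)] with n h2 h3 h4 h5 hn h6 h7
  have hn' : (0 : ℝ) < n := by exact_mod_cast hn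
  have hQ1 := S.Q1_pos n
  simp only [Function.comp] at h4
  set m := ⌊a * (n : ℝ)⌋₊ with hm
  have hXpos : 0 < S.reducedQ1 a s n m := S.reducedQ1_pos hs n m
  obtain ⟨Y, hY, hYeq⟩ := hD.exists_eq (mul_pos hr0 hXpos) h5.le
  rw [lt_div_iff₀ hQ1] at h2
  rcases le_or_gt Y (S.reducedQ21 a s t n m) with hle | hgt
  · rw [← hYeq]
    exact hD.mono hY (S.reducedQ21_mem hs ht n m) hle
  · exfalso
    have hYB : S.excess2 Y ≤ r' * S.reducedQ1 a s n m := by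
      rw [hYeq]; exact mul_le_mul_of_nonneg_right hr1.le hXpos.le
    have h8 := hD.linear_growth_of_lt hY hYB (S.reducedQ21_mem hs ht n) (K := m)
      (fun k hk => by
        rw [S.reducedQ21_succ hs ht]
        have h9 := Hδ _ _ (S.reducedQ1_mem hs n k) (S.reducedQ21_mem hs ht n k)
          ((S.reducedQ1_antitone hs n (Nat.zero_le k)).trans_lt h7)
          ((S.reducedQ21_le hs ht n k).trans_lt h6)
        rw [sub_sub_cancel] at h9
        have h10 := mul_le_mul_of_nonneg_left (S.reducedQ1_antitone (a := a) hs n hk.le)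
          (hr0.trans hr1).le
        linarith) hgt
    have h9 := h3 Y hY (by rw [hYeq]; nlinarith)
    have hrr : 0 < r' - r := sub_pos.2 hr1
    have hY0 := hY.1
    have ha0 := ha.1
    rw [div_lt_iff₀ (by positivity), hYeq] at h9
    rw [lt_div_iff₀ hn'] at h4
    rw [hYeq] at h8
    have h10 : a / 2 * n * ((r' - r) * S.reducedQ1 a s n m) < Y := by
      refine (mul_lt_mul_of_pos_right h4 (mul_pos hrr hXpos)).trans_le ?_
      linarith
    have h11 : r * Y < r * (a / 2 * n * ((r' - r) * S.reducedQ1 a s n m)) := by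
      have := mul_lt_mul_of_pos_right h9 hY0
      have e : n * (r * S.reducedQ1 a s n m / Y) * (a / 2 * (r' - r)) * Y
          = r * (a / 2 * n * ((r' - r) * S.reducedQ1 a s n m)) := by field_simp
      rwa [e] at this
    nlinarith [mul_lt_mul_of_pos_left h10 hr0]

/-- The quasi-stationary relation between the two components under Condition (B). -/
theorem CondB.tendsto_excess2_div (hB : S.CondB) (ha : a ∈ Set.Ioo (0 : ℝ) 1)
    (hs : s ∈ Set.Ico (0 : ℝ) 1) (ht : t ∈ Set.Ico (0 : ℝ) 1) :
    Tendsto (fun n : ℕ => S.excess2 (S.reducedQ21 a s t n ⌊a * (n : ℝ)⌋₊) /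
      S.reducedQ1 a s n ⌊a * (n : ℝ)⌋₊) atTop (𝓝 S.A21) := by
  rw [tendsto_order]
  constructor
  · intro c hc
    obtain ⟨r, hr1, hr2⟩ := exists_between (max_lt hc S.hA21)
    have hr0 : 0 < r := (le_max_right _ _).trans_lt hr1
    filter_upwards [hB.eventually_le_excess2 ha hs ht hr0 hr2] with n h
    rw [← le_div_iff₀ (S.reducedQ1_pos hs n _)] at h
    exact ((le_max_left _ _).trans_lt hr1).trans_le h
  · intro c hc
    obtain ⟨r, hr1, hr2⟩ := exists_between hc
    filter_upwards [hB.eventually_excess2_le ha hs ht hr1] with n h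
    rw [← div_le_iff₀ (S.reducedQ1_pos hs n _)] at h
    exact h.trans_lt hr2

theorem CondB.tendsto_excess2_Q21_div (hB : S.CondB) :
    Tendsto (fun n : ℕ => S.excess2 (S.Q21 n) / S.Q1 n) atTop (𝓝 S.A21) := by
  have h0 : (0 : ℝ) ∈ Set.Ico (0 : ℝ) 1 := ⟨le_rfl, one_pos⟩
  refine (hB.tendsto_excess2_div (a := 1 / 2) ⟨by norm_num, by norm_num⟩ h0 h0).congr fun n => ?_
  have hle : ⌊1 / 2 * (n : ℝ)⌋₊ ≤ n :=
    Nat.floor_le_of_le (by linarith [(Nat.cast_nonneg n : (0 : ℝ) ≤ n)])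
  rw [reducedQ1, reducedQ21, sub_zero, one_mul, one_mul, Q21s_one_sub_Q21, Q1s_one_sub_Q1,
    Nat.add_sub_cancel' hle]

theorem CondB.tendsto_reducedQ21_div (hB : S.CondB) (ha : a ∈ Set.Ioo (0 : ℝ) 1)
    (hs : s ∈ Set.Ico (0 : ℝ) 1) (ht : t ∈ Set.Ico (0 : ℝ) 1) :
    Tendsto (fun n : ℕ => S.reducedQ21 a s t n ⌊a * (n : ℝ)⌋₊ / S.Q21 n) atTop
      (𝓝 ((a + (1 - a) * (1 - s) ^ (-S.α1)) ^ (-1 / (S.α1 * (1 + S.α2))))) := by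
  have hD := S.criticalRV_excess2
  have hα1 := S.hα1.1
  have hα2 : 0 < 1 + S.α2 := by linarith [S.hα2.1]
  have hs1 : 0 < 1 - s := by linarith [hs.2]
  have hc : 0 < (1 - s) ^ (-S.α1) * (1 - a) + a :=
    add_pos (mul_pos (Real.rpow_pos_of_pos hs1 _) (by linarith [ha.2])) ha.1
  have h1 := ((hB.tendsto_excess2_div ha hs ht).mul
    (S.reducedQ1_asymptotics ha hs ha.1.le)).mul
    (hB.tendsto_excess2_Q21_div.inv₀ S.hA21.ne')
  have h2 := tendsto_div_of_regularlyVarying hα2 hD.mono (fun x hx => hD.pos hx) hD.rv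
    (u := fun n => S.reducedQ21 a s t n ⌊a * (n : ℝ)⌋₊) (v := S.Q21)
    (Eventually.of_forall fun n => S.reducedQ21_mem hs ht n _)
    (tendsto_nhdsWithin_iff.2 ⟨S.Q21_tendsto, Eventually.of_forall S.Q21_pos⟩)
    (r := ((1 - s) ^ (-S.α1) * (1 - a) + a)⁻¹ ^ (1 / S.α1))
    (Real.rpow_pos_of_pos (inv_pos.2 hc) _) (by
      have e : S.A21 * ((1 - s) ^ (-S.α1) * (1 - a) + a)⁻¹ ^ (1 / S.α1) * S.A21⁻¹
          = ((1 - s) ^ (-S.α1) * (1 - a) + a)⁻¹ ^ (1 / S.α1) := by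
        have := S.hA21.ne'
        field_simp
      rw [e] at h1
      refine h1.congr fun n => ?_
      have e1 := S.reducedQ1_pos (a := a) hs n ⌊a * (n : ℝ)⌋₊
      have e2 := S.Q1_pos n
      have e3 := hD.pos ⟨S.Q21_pos n, S.Q21_le_one n⟩
      field_simp)
  convert h2 using 2
  rw [← Real.rpow_mul (inv_pos.2 hc).le, Real.inv_rpow hc.le, ← Real.rpow_neg hc.le]
  congr 1
  · ring
  · field_simp

end GWSetup

/-- Theorem `T_zubQ3`(3).  Under Condition (B), for any
`s₁, s₂ ∈ (0,1)` and `a ∈ (0,1)`,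
`E[s₁^{Z₁(⌊an⌋,n)} s₂^{Z₂(⌊an⌋,n)} | Z(n) ≠ 0, Z(0) = e₂]
  → 1 - (a + (1-a)(1-s₁)^{-α₁})^{-1/(α₁(1+α₂))}`. -/
theorem condB_linear_reduced_pgf (S : GWSetup) (hB : S.CondB)
    (s1 s2 : ℝ) (hs1 : s1 ∈ Set.Ioo (0 : ℝ) 1) (hs2 : s2 ∈ Set.Ioo (0 : ℝ) 1)
    (a : ℝ) (ha : a ∈ Set.Ioo (0 : ℝ) 1) :
    Filter.Tendsto
      (fun n : ℕ => S.Ered ⌊a * (n : ℝ)⌋₊ n (fun k l => s1 ^ k * s2 ^ l))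
      Filter.atTop
      (nhds (1 - (a + (1 - a) * (1 - s1) ^ (-S.α1))
        ^ (-1 / (S.α1 * (1 + S.α2))))) := by
  refine ((hB.tendsto_reducedQ21_div ha ⟨hs1.1.le, hs1.2⟩
    ⟨hs2.1.le, hs2.2⟩).const_sub 1).congr fun n => ?_
  have hle : ⌊a * (n : ℝ)⌋₊ ≤ n :=
    Nat.floor_le_of_le (mul_le_of_le_one_left (Nat.cast_nonneg n) ha.2.le)
  rw [S.Ered_pow_eq hle ⟨hs1.1.le, hs1.2.le⟩ ⟨hs2.1.le, hs2.2.le⟩, GWSetup.reducedQ21]
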